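/- arXiv:2007.00065 — 3 statements merged into one kernel-verified Lean document; each statement's English description precedes it below -/
import Mathlib

section
/- Let n ≥ 1000 be an integer and let q be the largest prime with q ≤ n. Then R_{n,n}(x) has no factor of degree d in ℤ[x] for any d with 11 ≤ d ≤ q − 1. -/
open Polynomial Finset

/-- Probabilists' Hermite polynomials over `ℤ`:
`He 0 = 1`, `He 1 = X`, `He (n+1) = X * He n - n * He (n-1)`. -/
noncomputable def He : ℕ → Polynomial ℤ
  | 0 => 1
  | 1 => Polynomial.X
  | n + 2 => Polynomial.X * He (n + 1) - Polynomial.C ((n : ℤ) + 1) * He n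

/-- The Wronskian `Wr[He_{n_1}, …, He_{n_r}]` of the Hermite polynomials indexed by
a degree sequence `ns : Fin r → ℕ`; entry `(i,j)` is the `i`-th derivative of `He (ns j)`. -/
noncomputable def wronskHe {r : ℕ} (ns : Fin r → ℕ) : Polynomial ℤ :=
  Matrix.det (Matrix.of fun i j : Fin r =>
    (fun q : Polynomial ℤ => Polynomial.derivative q)^[(i : ℕ)] (He (ns j)))

/-- `Δ(n_λ) = ∏_{i<j} (n_j - n_i)`. -/
def vand {r : ℕ} (ns : Fin r → ℕ) : ℤ :=
  ∏ j : Fin r, ∏ i ∈ Finset.Iio j, ((ns j : ℤ) - (ns i : ℤ))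

/-- The degree sequence `n_λ` of a partition `λ = (λ_1 ≥ … ≥ λ_r)`,
`n_i = λ_{r+1-i} + (i-1)` (indices shifted to start at `0`). -/
def degSeq {r : ℕ} (lam : Fin r → ℕ) : Fin r → ℕ :=
  fun i => lam i.rev + (i : ℕ)

/-- `d_λ` = (number of odd entries of the degree sequence) − (number of even entries). -/
def dStat {r : ℕ} (ns : Fin r → ℕ) : ℤ :=
  ((Finset.univ.filter fun i => Odd (ns i)).card : ℤ) -
    ((Finset.univ.filter fun i => Even (ns i)).card : ℤ)

/-- `s_λ = d_λ(d_λ+1)/2`, the size of the 2-core of `λ`. -/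
def sStat {r : ℕ} (ns : Fin r → ℕ) : ℕ :=
  (dStat ns * (dStat ns + 1) / 2).toNat

theorem Nat.choose_mul_pow_mul_pow_le (n k x y : ℕ) (hk : k ≤ n) :
    n.choose k * (x ^ k * y ^ (n - k)) ≤ (x + y) ^ n := by
  rw [add_pow]
  refine le_trans (le_of_eq ?_) (Finset.single_le_sum (f := fun m => x ^ m * y ^ (n - m) * n.choose m)
    (fun i _ => Nat.zero_le _) (Finset.mem_range.2 (Nat.lt_succ_of_le hk)))
  ring

theorem Nat.Prime.dvd_of_factorial_eq_mul {p N e M : ℕ} (hp : p.Prime) (he : e < p) (hpN : p ≤ N)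
    (h : M * ((N / 2).factorial * (N / 3).factorial * (N / 7).factorial * e.factorial)
      = N.factorial) : p ∣ M := by
  have hM : M ≠ 0 := by
    rintro rfl
    simp [N.factorial_ne_zero.symm] at h
  by_contra hdvd
  have h1 := congrArg (fun m => m.factorization p) h
  rw [Nat.factorization_mul hM (by positivity), Nat.factorization_mul (by positivity) (by positivity),
    Nat.factorization_mul (by positivity) (by positivity),
    Nat.factorization_mul (by positivity) (by positivity)] at h1
  simp only [Finsupp.add_apply, Nat.factorization_factorial_eq_zero_of_lt he,
    Nat.factorization_eq_zero_of_not_dvd hdvd] at h1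
  have hb : ∀ m ≤ N, Nat.log p m < Nat.log p N + 1 :=
    fun m hm => Nat.lt_succ_of_le (Nat.log_mono_right hm)
  rw [Nat.factorization_factorial hp (hb _ (Nat.div_le_self _ _)),
    Nat.factorization_factorial hp (hb _ (Nat.div_le_self _ _)),
    Nat.factorization_factorial hp (hb _ (Nat.div_le_self _ _)),
    Nat.factorization_factorial hp (hb _ le_rfl), zero_add, add_zero, ← Finset.sum_add_distrib,
    ← Finset.sum_add_distrib] at h1
  refine h1.not_lt (Finset.sum_lt_sum (fun i _ => ?_) ⟨1, ?_, ?_⟩)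
  · simp only [Nat.div_right_comm N]
    generalize N / p ^ i = t
    omega
  · have := Nat.log_pos hp.one_lt hpN
    exact Finset.mem_Ico.2 ⟨le_rfl, by omega⟩
  · simp only [Nat.div_right_comm N, pow_one]
    have := Nat.div_pos hpN hp.pos
    omega

theorem primorial_mul_le (N e : ℕ) (he : N / 2 + N / 3 + N / 7 + e = N) :
    primorial N * (21 ^ (N / 2) * 14 ^ (N / 3) * 6 ^ (N / 7)) ≤ primorial e * 42 ^ N := by
  set a := N / 2 with ha
  set b := N / 3 with hb
  set c := N / 7 with hc
  set M := N.choose a * (N - a).choose b * (N - a - b).choose c with hM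
  have hfac : M * (a.factorial * b.factorial * c.factorial * e.factorial) = N.factorial := by
    have h1 := Nat.choose_mul_factorial_mul_factorial (n := N) (k := a) (by omega)
    have h2 := Nat.choose_mul_factorial_mul_factorial (n := N - a) (k := b) (by omega)
    have h3 := Nat.choose_mul_factorial_mul_factorial (n := N - a - b) (k := c) (by omega)
    have h4 : N - a - b - c = e := by omega
    rw [h4] at h3
    rw [← h1, ← h2, ← h3, hM]
    ring
  have hMpos : 0 < M := Nat.pos_of_ne_zero (by
    rintro h
    rw [h, zero_mul] at hfac
    exact N.factorial_ne_zero hfac.symm)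
  have hle : primorial N ≤ primorial e * M := by
    have hsplit : primorial N = primorial e * ∏ p ∈ Finset.Ico (e + 1) (N + 1) with p.Prime, p := by
      rw [primorial, primorial, ← Finset.prod_union]
      · congr 1
        ext p
        simp only [Finset.mem_filter, Finset.mem_range, Finset.mem_union, Finset.mem_Ico]
        have : e ≤ N := by omega
        constructor
        · rintro ⟨h, hp⟩
          by_cases hpe : p < e + 1
          · exact Or.inl ⟨hpe, hp⟩
          · exact Or.inr ⟨⟨by omega, h⟩, hp⟩
        · rintro (⟨h, hp⟩ | ⟨h, hp⟩)
          · exact ⟨by omega, hp⟩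
          · exact ⟨h.2, hp⟩
      · rw [Finset.disjoint_left]
        intro p hp hp'
        simp only [Finset.mem_filter, Finset.mem_range, Finset.mem_Ico] at hp hp'
        omega
    rw [hsplit]
    refine Nat.mul_le_mul_left _ (Nat.le_of_dvd hMpos ?_)
    refine Finset.prod_primes_dvd _ (fun p hp => ?_) (fun p hp => ?_)
    · exact (Finset.mem_filter.1 hp).2.prime
    · simp only [Finset.mem_filter, Finset.mem_Ico] at hp
      exact hp.2.dvd_of_factorial_eq_mul (by omega) (by omega) hfac
  have hMle : M * (21 ^ a * 14 ^ b * 6 ^ c) ≤ 42 ^ N := by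
    have h1 := Nat.choose_mul_pow_mul_pow_le N a 21 21 (by omega)
    have h2 := Nat.choose_mul_pow_mul_pow_le (N - a) b 14 7 (by omega)
    have h3 := Nat.choose_mul_pow_mul_pow_le (N - a - b) c 6 1 (by omega)
    norm_num at h1 h2 h3
    calc M * (21 ^ a * 14 ^ b * 6 ^ c)
        = N.choose a * 21 ^ a * ((N - a).choose b * 14 ^ b * ((N - a - b).choose c * 6 ^ c)) := by
          rw [hM]; ring
      _ ≤ N.choose a * 21 ^ a * ((N - a).choose b * 14 ^ b * 7 ^ (N - a - b)) := by gcongr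
      _ ≤ N.choose a * 21 ^ a * 21 ^ (N - a) := by
          gcongr; rw [mul_assoc]; exact h2
      _ ≤ 42 ^ N := by rw [mul_assoc]; exact h1
  calc primorial N * (21 ^ a * 14 ^ b * 6 ^ c)
      ≤ primorial e * M * (21 ^ a * 14 ^ b * 6 ^ c) := by gcongr
    _ = primorial e * (M * (21 ^ a * 14 ^ b * 6 ^ c)) := by ring
    _ ≤ primorial e * 42 ^ N := by gcongr

/-- Exponent comparison driving the induction in `primorial_le_pow`. -/
theorem two_three_seven_pow_le (N : ℕ) (hN : 1260 ≤ N) :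
    ∀ e, N / 2 + N / 3 + N / 7 + e = N → 42 ^ N * 25 ^ (N - e) ≤
      76 ^ (N - e) * (21 ^ (N / 2) * 14 ^ (N / 3) * 6 ^ (N / 7)) := by
  induction N using Nat.strong_induction_on with
  | _ N ih =>
    intro e he
    by_cases h : N < 1302
    · have key : ∀ r < 42, 42 ^ (1260 + r) * 25 ^ ((1260 + r) / 2 + (1260 + r) / 3 + (1260 + r) / 7)
          ≤ 76 ^ ((1260 + r) / 2 + (1260 + r) / 3 + (1260 + r) / 7) *
            (21 ^ ((1260 + r) / 2) * 14 ^ ((1260 + r) / 3) * 6 ^ ((1260 + r) / 7)) := by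
        decide +kernel
      have := key (N - 1260) (by omega)
      rw [show 1260 + (N - 1260) = N by omega] at this
      rwa [show N - e = N / 2 + N / 3 + N / 7 by omega]
    · obtain ⟨m, rfl⟩ : ∃ m, N = m + 42 := ⟨N - 42, by omega⟩
      have := ih m (by omega) (by omega) (e - 1) (by omega)
      rw [show (m + 42) / 2 = m / 2 + 21 by omega, show (m + 42) / 3 = m / 3 + 14 by omega,
        show (m + 42) / 7 = m / 7 + 6 by omega, show m + 42 - e = m - (e - 1) + 41 by omega]
      calc 42 ^ (m + 42) * 25 ^ (m - (e - 1) + 41)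
          = (42 ^ m * 25 ^ (m - (e - 1))) * (42 ^ 42 * 25 ^ 41) := by ring
        _ ≤ (76 ^ (m - (e - 1)) * (21 ^ (m / 2) * 14 ^ (m / 3) * 6 ^ (m / 7))) *
            (76 ^ 41 * (21 ^ 21 * 14 ^ 14 * 6 ^ 6)) := Nat.mul_le_mul this (by norm_num)
        _ = _ := by ring

/-- A decidable superset of the primes, which contains no composite number below `37 ^ 2`. -/
def MaybePrime (m : ℕ) : Bool :=
  (Nat.blt 1 m && Nat.gcd m 200560490130 == 1) ||
    [2, 3, 5, 7, 11, 13, 17, 19, 23, 29, 31].contains m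

theorem Nat.Prime.maybePrime {p : ℕ} (hp : p.Prime) : MaybePrime p = true := by
  unfold MaybePrime
  by_cases h : p ∣ 200560490130
  · have : (200560490130 : ℕ) = 2 * 3 * 5 * 7 * 11 * 13 * 17 * 19 * 23 * 29 * 31 := by norm_num
    rw [this] at h
    simp only [hp.dvd_mul, Nat.prime_dvd_prime_iff_eq hp (show Nat.Prime 2 by norm_num),
      Nat.prime_dvd_prime_iff_eq hp (show Nat.Prime 3 by norm_num),
      Nat.prime_dvd_prime_iff_eq hp (show Nat.Prime 5 by norm_num),
      Nat.prime_dvd_prime_iff_eq hp (show Nat.Prime 7 by norm_num),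
      Nat.prime_dvd_prime_iff_eq hp (show Nat.Prime 11 by norm_num),
      Nat.prime_dvd_prime_iff_eq hp (show Nat.Prime 13 by norm_num),
      Nat.prime_dvd_prime_iff_eq hp (show Nat.Prime 17 by norm_num),
      Nat.prime_dvd_prime_iff_eq hp (show Nat.Prime 19 by norm_num),
      Nat.prime_dvd_prime_iff_eq hp (show Nat.Prime 23 by norm_num),
      Nat.prime_dvd_prime_iff_eq hp (show Nat.Prime 29 by norm_num),
      Nat.prime_dvd_prime_iff_eq hp (show Nat.Prime 31 by norm_num)] at h
    have h' : p ∈ [2, 3, 5, 7, 11, 13, 17, 19, 23, 29, 31] := by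
      simp only [List.mem_cons, List.not_mem_nil]; tauto
    simp [h']
  · have := (Nat.Prime.coprime_iff_not_dvd hp).2 h
    simp [Nat.Coprime] at this
    have h1 : Nat.blt 1 p = true := by simpa using hp.one_lt
    simp [this, h1]

/-- The product of the `m ≤ x` with `MaybePrime m`, together with a flag saying that the bound
`25 ^ y * _ ≤ 76 ^ y` holds for the products up to all `0 < y ≤ x`. -/
def maybePrimorial (x : ℕ) : ℕ × Bool :=
  Nat.rec (1, true) (fun n s =>
    (if MaybePrime (n + 1) then (n + 1) * s.1 else s.1,
      s.2 && Nat.ble (25 ^ (n + 1) * (if MaybePrime (n + 1) then (n + 1) * s.1 else s.1))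
        (76 ^ (n + 1)))) x

theorem primorial_succ_le (n P : ℕ) (h : primorial n ≤ P) :
    primorial (n + 1) ≤ if MaybePrime (n + 1) then (n + 1) * P else P := by
  have hstep : primorial (n + 1) = if (n + 1).Prime then (n + 1) * primorial n else primorial n := by
    rw [primorial, primorial, Finset.range_add_one (n := n + 1), Finset.filter_insert]
    split_ifs
    · rw [Finset.prod_insert (by simp)]
    · rfl
  rw [hstep]
  split_ifs with h1 h2 h2
  · gcongr
  · exact absurd h1.maybePrime h2
  · nlinarith [Nat.zero_le (n * P)]
  · exact h

theorem maybePrimorial_spec (x : ℕ) : primorial x ≤ (maybePrimorial x).1 ∧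
    ((maybePrimorial x).2 = true → ∀ y ≤ x, 25 ^ y * primorial y ≤ 76 ^ y) := by
  induction x with
  | zero => simp [maybePrimorial]
  | succ n ih =>
    obtain ⟨h1, h2⟩ := ih
    have h3 := primorial_succ_le n _ h1
    refine ⟨h3, fun h y hy => ?_⟩
    have h : ((maybePrimorial n).2 && Nat.ble (25 ^ (n + 1) * (if MaybePrime (n + 1) then
      (n + 1) * (maybePrimorial n).1 else (maybePrimorial n).1)) (76 ^ (n + 1))) = true := h
    rw [Bool.and_eq_true] at h
    rcases Nat.lt_or_ge n y with hlt | hle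
    · obtain rfl : y = n + 1 := by omega
      exact (Nat.mul_le_mul_left _ h3).trans (Nat.le_of_ble_eq_true h.2)
    · exact h2 h.1 y hle

theorem primorial_le_pow (N : ℕ) : 25 ^ N * primorial N ≤ 76 ^ N := by
  induction N using Nat.strong_induction_on with
  | _ N ih =>
    by_cases h : N < 1260
    · exact (maybePrimorial_spec 1260).2 (by decide +kernel) N h.le
    · obtain ⟨e, he⟩ : ∃ e, N / 2 + N / 3 + N / 7 + e = N :=
        ⟨N - (N / 2 + N / 3 + N / 7), by omega⟩
      have h1 := primorial_mul_le N e he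
      have h2 := two_three_seven_pow_le N (by omega) e he
      have h3 := ih e (by omega)
      set Q := 21 ^ (N / 2) * 14 ^ (N / 3) * 6 ^ (N / 7)
      refine Nat.le_of_mul_le_mul_right (c := Q) ?_ (by positivity)
      have hN : N = e + (N - e) := by omega
      calc 25 ^ N * primorial N * Q = 25 ^ N * (primorial N * Q) := by ring
        _ ≤ 25 ^ N * (primorial e * 42 ^ N) := by gcongr
        _ = (25 ^ e * primorial e) * (42 ^ N * 25 ^ (N - e)) := by
            conv_lhs => rw [hN, pow_add]
            rw [← hN]; ring
        _ ≤ 76 ^ e * (76 ^ (N - e) * Q) := Nat.mul_le_mul h3 h2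
        _ = 76 ^ N * Q := by
            rw [← mul_assoc, ← pow_add, ← hN]

theorem Nat.choose_mul_pow_le_choose_mul_pow {m n : ℕ} (h : m ≤ n) (k : ℕ) :
    m.choose k * n ^ k ≤ n.choose k * m ^ k := by
  have key : m.descFactorial k * n ^ k ≤ n.descFactorial k * m ^ k := by
    induction k with
    | zero => simp
    | succ k ih =>
      rw [Nat.descFactorial_succ, Nat.descFactorial_succ, pow_succ, pow_succ]
      have h1 : (m - k) * n ≤ (n - k) * m := by
        rw [Nat.sub_mul, Nat.sub_mul, mul_comm n m]
        exact Nat.sub_le_sub_left (Nat.mul_le_mul_left k h) _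
      calc (m - k) * m.descFactorial k * (n ^ k * n)
          = (m.descFactorial k * n ^ k) * ((m - k) * n) := by ring
        _ ≤ (n.descFactorial k * m ^ k) * ((n - k) * m) := Nat.mul_le_mul ih h1
        _ = _ := by ring
  rw [Nat.descFactorial_eq_factorial_mul_choose, Nat.descFactorial_eq_factorial_mul_choose,
    mul_assoc, mul_assoc] at key
  exact Nat.le_of_mul_le_mul_left key k.factorial_pos

theorem Nat.pow_le_choose_four_mul (k : ℕ) (hk : 1 ≤ k) :
    256 ^ k ≤ 4 * k * (4 * k).choose k * 27 ^ k := by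
  induction k, hk using Nat.le_induction with
  | base => simp [Nat.choose]
  | succ k hk ih =>
    have h1 : (4 * (k + 1)).choose (k + 1) * ((k + 1) * ((3 * k + 1) * (3 * k + 2) * (3 * k + 3))) =
        (4 * k).choose k * ((4 * k + 1) * (4 * k + 2) * (4 * k + 3) * (4 * k + 4)) := by
      have a1 := Nat.add_one_mul_choose_eq (4 * k + 3) k
      have a2 := Nat.choose_mul_succ_eq (4 * k) k
      have a3 := Nat.choose_mul_succ_eq (4 * k + 1) k
      have a4 := Nat.choose_mul_succ_eq (4 * k + 2) k
      rw [show 4 * k + 1 - k = 3 * k + 1 by omega] at a2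
      rw [show 4 * k + 1 + 1 - k = 3 * k + 2 by omega] at a3
      rw [show 4 * k + 2 + 1 - k = 3 * k + 3 by omega] at a4
      rw [show 4 * (k + 1) = 4 * k + 3 + 1 by ring]
      calc _ = ((4 * k + 3 + 1).choose (k + 1) * (k + 1)) *
            ((3 * k + 1) * (3 * k + 2) * (3 * k + 3)) := by ring
        _ = (4 * k + 3 + 1) * ((4 * k + 2 + 1).choose k * (3 * k + 3)) *
            ((3 * k + 1) * (3 * k + 2)) := by rw [← a1]; ring
        _ = (4 * k + 3 + 1) * (4 * k + 2 + 1) * ((4 * k + 1 + 1).choose k * (3 * k + 2)) *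
            (3 * k + 1) := by rw [← a4]; ring
        _ = (4 * k + 3 + 1) * (4 * k + 2 + 1) * (4 * k + 1 + 1) *
            ((4 * k + 1).choose k * (3 * k + 1)) := by rw [← a3]; ring
        _ = _ := by rw [← a2]; ring
    have h2 : 256 * k * ((k + 1) * ((3 * k + 1) * (3 * k + 2) * (3 * k + 3))) ≤
        27 * (k + 1) * ((4 * k + 1) * (4 * k + 2) * (4 * k + 3) * (4 * k + 4)) := by
      have : 768 * (k * ((3 * k + 1) * (3 * k + 2))) ≤
          108 * ((4 * k + 1) * (4 * k + 2) * (4 * k + 3)) := by nlinarith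
      calc _ = 768 * (k * ((3 * k + 1) * (3 * k + 2))) * (k + 1) ^ 2 := by ring
        _ ≤ 108 * ((4 * k + 1) * (4 * k + 2) * (4 * k + 3)) * (k + 1) ^ 2 := by gcongr
        _ = _ := by ring
    set D := (k + 1) * ((3 * k + 1) * (3 * k + 2) * (3 * k + 3)) with hD
    refine Nat.le_of_mul_le_mul_right (c := k * D) ?_ (by positivity)
    calc 256 ^ (k + 1) * (k * D) = 256 ^ k * (256 * k * D) := by ring
      _ ≤ (4 * k * (4 * k).choose k * 27 ^ k) * (27 * (k + 1) *
          ((4 * k + 1) * (4 * k + 2) * (4 * k + 3) * (4 * k + 4))) := Nat.mul_le_mul ih h2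
      _ = 4 * (k + 1) * 27 ^ (k + 1) * k * ((4 * k).choose k *
          ((4 * k + 1) * (4 * k + 2) * (4 * k + 3) * (4 * k + 4))) := by ring
      _ = _ := by rw [← h1]; ring

theorem Nat.choose_eq_prod_primesLE {n k y : ℕ} (hkn : k ≤ n)
    (hy : ∀ p, p.Prime → p ∣ n.choose k → p ≤ y) :
    n.choose k = ∏ p ∈ Nat.primesLE y, p ^ (n.choose k).factorization p := by
  conv_lhs => rw [← Nat.prod_factorization_pow_eq_self (Nat.choose_pos hkn).ne']
  refine Finsupp.prod_of_support_subset _ (fun p hp => ?_) _ (fun _ _ => pow_zero _)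
  rw [Nat.support_factorization] at hp
  have hpp := Nat.prime_of_mem_primeFactors hp
  exact Nat.mem_primesLE.2 ⟨hy p hpp (Nat.dvd_of_mem_primeFactors hp), hpp⟩

theorem Nat.choose_le_pow_primeCounting {n k y : ℕ} (hn : 0 < n) (hkn : k ≤ n)
    (hy : ∀ p, p.Prime → p ∣ n.choose k → p ≤ y) : n.choose k ≤ n ^ Nat.primeCounting y := by
  rw [Nat.choose_eq_prod_primesLE hkn hy, ← Nat.primesLE_card_eq_primeCounting]
  exact Finset.prod_le_pow_card _ _ _ fun p _ => Nat.pow_factorization_choose_le hn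

theorem Nat.choose_le_primorial_mul_pow {n k y : ℕ} (hn : 0 < n) (hkn : k ≤ n)
    (hy : ∀ p, p.Prime → p ∣ n.choose k → p ≤ y) :
    n.choose k ≤ primorial y * n ^ Nat.primeCounting n.sqrt := by
  have h1 : n.choose k ≤ ∏ p ∈ Nat.primesLE y, (p * if p ≤ n.sqrt then n else 1) := by
    conv_lhs => rw [Nat.choose_eq_prod_primesLE hkn hy]
    refine Finset.prod_le_prod' fun p hp => ?_
    have hpp := Nat.prime_of_mem_primesLE hp
    split_ifs with h
    · exact (Nat.pow_factorization_choose_le hn).trans (Nat.le_mul_of_pos_left _ hpp.pos)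
    · rw [mul_one]
      have := Nat.factorization_choose_le_one (k := k) (p := p) (n := n)
        (by rw [sq]; exact Nat.sqrt_lt.1 (by omega))
      exact (Nat.pow_le_pow_right hpp.pos this).trans (by simp)
  refine h1.trans ?_
  rw [Finset.prod_mul_distrib, ← primorial_eq_prod_primesLE, ← Finset.prod_filter,
    Finset.prod_const]
  refine Nat.mul_le_mul_left _ (Nat.pow_le_pow_right hn ?_)
  rw [← Nat.primesLE_card_eq_primeCounting]
  refine Finset.card_le_card fun p hp => ?_
  simp only [Finset.mem_filter, Nat.mem_primesLE] at hp ⊢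
  exact ⟨hp.2, hp.1.2⟩

theorem Nat.Prime.exists_dvd_sub_of_dvd_choose {p n k : ℕ} (hp : p.Prime) (h : p ∣ n.choose k) :
    ∃ j < k, p ∣ n - j := by
  have : p ∣ n.descFactorial k := by
    rw [Nat.descFactorial_eq_factorial_mul_choose]; exact h.mul_left _
  rw [Nat.descFactorial_eq_prod_range, hp.prime.dvd_finsetProd_iff] at this
  obtain ⟨j, hj, hd⟩ := this
  exact ⟨j, Finset.mem_range.1 hj, hd⟩

/-- The number of `m ≤ x` with `MaybePrime m`. -/
def maybeCount (x : ℕ) : ℕ :=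
  Nat.rec 0 (fun n c => if MaybePrime (n + 1) then c + 1 else c) x

theorem Nat.primeCounting_le_maybeCount (x : ℕ) : Nat.primeCounting x ≤ maybeCount x := by
  induction x with
  | zero => simp [maybeCount]
  | succ n ih =>
    have h : maybeCount (n + 1) =
      if MaybePrime (n + 1) then maybeCount n + 1 else maybeCount n := rfl
    have h' : Nat.primeCounting (n + 1) =
        Nat.primeCounting n + if (n + 1).Prime then 1 else 0 := by
      rw [Nat.primeCounting, Nat.primeCounting', Nat.count_succ]; rfl
    rw [h, h']
    split_ifs with h1 h2 h2
    · omega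
    · exact absurd h1.maybePrime h2
    · omega
    · omega

theorem Nat.four_mul_primeCounting_add_le {x : ℕ} (hx : 800 ≤ x) :
    4 * Nat.primeCounting x + 8 ≤ x := by
  by_cases h : x < 1700
  · have key : ∀ i < 90, 4 * maybeCount (10 * (i + 80) + 9) + 8 ≤ 10 * (i + 80) := by
      decide +kernel
    have h1 := key (x / 10 - 80) (by omega)
    have h2 : Nat.primeCounting x ≤ Nat.primeCounting (10 * (x / 10 - 80 + 80) + 9) :=
      Nat.monotone_primeCounting (by omega)
    have h3 := Nat.primeCounting_le_maybeCount (10 * (x / 10 - 80 + 80) + 9)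
    omega
  · have h1 := Nat.primeCounting_add_le (a := 210) (k := 1499) (by norm_num) (by norm_num) (x - 1499)
    have h2 : maybeCount 1499 ≤ 245 := by decide +kernel
    have h3 := Nat.primeCounting_le_maybeCount 1499
    have h4 : Nat.totient 210 = 48 := by decide +kernel
    rw [h4, show 1499 + (x - 1499) = x by omega] at h1
    omega

theorem Nat.four_mul_primeCounting_le (x : ℕ) : 4 * Nat.primeCounting x ≤ x + 13 := by
  by_cases h : 800 ≤ x
  · have := Nat.four_mul_primeCounting_add_le h
    omega
  · have key : ∀ x < 800, 4 * maybeCount x ≤ x + 13 := by decide +kernel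
    have := key x (by omega)
    have := Nat.primeCounting_le_maybeCount x
    omega

theorem Nat.exists_prime_gt_dvd_of_not_dvd {m y : ℕ} (hm : 0 < m) (hm' : m < 2 ^ 13)
    (h : ¬ m ∣ primorial y ^ 13) : ∃ p, p.Prime ∧ y < p ∧ p ∣ m := by
  by_contra! hcon
  refine h ((Nat.factorization_le_iff_dvd hm.ne' (by positivity [primorial_pos y])).1 fun p => ?_)
  by_cases hp : p ∈ m.primeFactors
  · have hpp := Nat.prime_of_mem_primeFactors hp
    have hpd := Nat.dvd_of_mem_primeFactors hp
    have hy : p ≤ y := by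
      by_contra hlt
      exact hcon p hpp (by omega) hpd
    have h1 := (hpp.dvd_iff_one_le_factorization (primorial_ne_zero y)).1
      (hpp.dvd_primorial_iff.2 hy)
    have h2 : m.factorization p < 13 := by
      rw [← Nat.pow_lt_pow_iff_right (a := 2) (by norm_num)]
      exact ((Nat.pow_le_pow_left hpp.two_le _).trans
        (Nat.le_of_dvd hm (Nat.ordProj_dvd m p))).trans_lt hm'
    simp only [Nat.factorization_pow, Finsupp.smul_apply, smul_eq_mul]
    omega
  · rw [← Nat.support_factorization, Finsupp.notMem_support_iff] at hp
    simp [hp]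

theorem Nat.exists_prime_gt_two_mul_of_lt_choose {n k y : ℕ} (hn : 0 < n) (hkn : k ≤ n)
    (h : n ^ Nat.primeCounting y < n.choose k) :
    ∃ p, p.Prime ∧ y < p ∧ ∃ j < k, p ∣ n - j := by
  by_contra! hcon
  refine h.not_ge (Nat.choose_le_pow_primeCounting hn hkn fun p hp hd => ?_)
  by_contra hlt
  obtain ⟨j, hj, hdj⟩ := hp.exists_dvd_sub_of_dvd_choose hd
  exact hcon p hp (by omega) j hj hdj

theorem Nat.pow_lt_choose_of_le {m n k c : ℕ} (hmn : m ≤ n) (hm : 0 < m) (hc : c ≤ k)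
    (h : m ^ c < m.choose k) : n ^ c < n.choose k := by
  have h1 := Nat.choose_mul_pow_le_choose_mul_pow hmn k
  have hn : 0 < n := hm.trans_le hmn
  refine Nat.lt_of_mul_lt_mul_right (a := m ^ k) (lt_of_lt_of_le ?_ h1)
  obtain ⟨d, rfl⟩ := Nat.exists_eq_add_of_le hc
  calc n ^ c * m ^ (c + d) = m ^ c * (n ^ c * m ^ d) := by ring
    _ ≤ m ^ c * (n ^ c * n ^ d) := by gcongr
    _ = m ^ c * n ^ (c + d) := by ring
    _ < _ := by gcongr

theorem Nat.exists_prime_gt_two_mul_of_lt_four_hundred {n k : ℕ} (hn : 1000 ≤ n) (hk : 6 ≤ k)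
    (hk' : k < 400) (hkn : 9 * k ≤ n) : ∃ p, p.Prime ∧ 2 * k < p ∧ ∃ j < k, p ∣ n - j := by
  have large : ∀ m, 1000 ≤ m → m ≤ n → maybeCount (2 * k) ≤ k →
      k.factorial * m ^ maybeCount (2 * k) < m.descFactorial k →
      ∃ p, p.Prime ∧ 2 * k < p ∧ ∃ j < k, p ∣ n - j := by
    intro m hm hmn hc h
    refine Nat.exists_prime_gt_two_mul_of_lt_choose (by omega) (by omega)
      (lt_of_le_of_lt (Nat.pow_le_pow_right (by omega) (Nat.primeCounting_le_maybeCount _))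
        (Nat.pow_lt_choose_of_le hmn (by omega) hc ?_))
    rw [Nat.descFactorial_eq_factorial_mul_choose] at h
    exact Nat.lt_of_mul_lt_mul_left h
  have smooth : ∀ y M, primorial y = M → 2 * k ≤ y → n < 2 ^ 13 →
      ((List.range k).any fun j => !((M ^ 13) % (n - j) == 0)) = true →
      ∃ p, p.Prime ∧ 2 * k < p ∧ ∃ j < k, p ∣ n - j := by
    intro y M hM hy hn' h
    simp only [List.any_eq_true, List.mem_range, Bool.not_eq_true', beq_eq_false_iff_ne] at h
    obtain ⟨j, hj, hne⟩ := h
    obtain ⟨p, hp, hyp, hd⟩ := Nat.exists_prime_gt_dvd_of_not_dvd (m := n - j) (y := y)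
      (by omega) (by omega) (by rw [hM, Nat.dvd_iff_mod_eq_zero]; exact hne)
    exact ⟨p, hp, by omega, j, hj, hd⟩
  by_cases h7 : k = 7
  · subst h7
    by_cases h : n < 5061
    · have key : ∀ a < 64, ∀ b < 64, ((List.range 7).any fun j =>
          !((30030 ^ 13) % (1000 + 64 * a + b - j) == 0)) = true := by decide +kernel
      have := key ((n - 1000) / 64) (by omega) ((n - 1000) % 64) (by omega)
      rw [show 1000 + 64 * ((n - 1000) / 64) + (n - 1000) % 64 = n by omega] at this
      exact smooth 14 30030 (by decide) (by norm_num) (by omega) this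
    · exact large 5061 (by norm_num) (by omega) (by decide +kernel) (by decide +kernel)
  by_cases h10 : k = 10
  · subst h10
    by_cases h : n < 1928
    · have key : ∀ i < 928, ((List.range 10).any fun j =>
          !((9699690 ^ 13) % (1000 + i - j) == 0)) = true := by decide +kernel
      have := key (n - 1000) (by omega)
      rw [show 1000 + (n - 1000) = n by omega] at this
      exact smooth 20 9699690 (by decide +kernel) (by norm_num) (by omega) this
    · exact large 1928 (by norm_num) (by omega) (by decide +kernel) (by decide +kernel)
  have key : ∀ i < 394, i ≠ 1 → i ≠ 4 → maybeCount (2 * (i + 6)) ≤ i + 6 ∧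
      (i + 6).factorial * (max 1000 (9 * (i + 6))) ^ maybeCount (2 * (i + 6)) <
        (max 1000 (9 * (i + 6))).descFactorial (i + 6) := by decide +kernel
  have := key (k - 6) (by omega) (by omega) (by omega)
  rw [show k - 6 + 6 = k by omega] at this
  exact large _ (le_max_left _ _) (max_le hn hkn) this.1 this.2

theorem Nat.exists_prime_of_isChain (L : List ℕ) : ∀ p n : ℕ,
    List.IsChain (fun p q => 8 * q < 9 * p + 8) (p :: L) → (∀ r ∈ p :: L, r.Prime) → p ≤ n →
    8 * n < 9 * (p :: L).getLast (List.cons_ne_nil p L) → ∃ r, r.Prime ∧ r ≤ n ∧ 8 * n < 9 * r := by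
  induction L with
  | nil => exact fun p n _ hp hpn hn => ⟨p, hp p (by simp), hpn, hn⟩
  | cons q L ih =>
    intro p n hc hp hpn hn
    rw [List.isChain_cons_cons] at hc
    by_cases h : q ≤ n
    · exact ih q n hc.2 (fun r hr => hp r (List.mem_cons_of_mem _ hr)) h
        (by rwa [List.getLast_cons_cons] at hn)
    · exact ⟨p, hp p (by simp), hpn, by omega⟩

theorem Nat.exists_prime_lt_nine_mul {n : ℕ} (hn : 1000 ≤ n) (hn' : n < 2970000) :
    ∃ p, p.Prime ∧ p ≤ n ∧ 8 * n < 9 * p := by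
  refine Nat.exists_prime_of_isChain [
      1117, 1249, 1399, 1571, 1759, 1979, 2221, 2477, 2777, 3121, 3511, 3947, 4441, 4993,
      5591, 6287, 7069, 7951, 8941, 10039, 11287, 12697, 14281, 16067, 18061, 20297, 22817,
      25667, 28871, 32479, 36529, 41081, 46199, 51973, 58453, 65731, 73943, 83177, 93563,
      105253, 118409, 133201, 149839, 168559, 189619, 213319, 239977, 269953, 303691, 341647,
      384343, 432373, 486407, 547171, 615557, 692467, 779021, 876373, 985903, 1109123,
      1247761, 1403693, 1579141, 1776499, 1998559, 2248373, 2529419, 2845571] 997 n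
    (by decide +kernel) ?_ (by omega) ?_
  · simp only [List.forall_mem_cons]
    norm_num
  · simp only [List.getLast_cons_cons, List.getLast_singleton]
    omega

theorem Real.sqrt_add_mul_log_lt {k t : ℝ} (hk : 400 ≤ k) (htk : t ≤ k)
    (ht : 3 * √k ≤ t ∨ 330000 ≤ k ∧ 2 * √k ≤ t) :
    log k + 5.48 + (t + 13) * log k / 2 < k * (2 * log t - log (4 * k) + 0.025) := by
  have h2 := Real.log_two_lt_d9
  have h2' := Real.log_two_gt_d9
  have h4 : log 4 = 2 * log 2 := by
    rw [show (4 : ℝ) = 2 ^ 2 by norm_num, Real.log_pow]; norm_num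
  have hk0 : 0 < k := by linarith
  set w := √k with hw
  have hw2 : w ^ 2 = k := Real.sq_sqrt hk0.le
  have hw0 : 20 ≤ w := by rw [hw, Real.le_sqrt (by norm_num) hk0.le]; linarith
  have hLw : log k = 2 * log w := by rw [← hw2, Real.log_pow]; norm_num
  have h4k : log (4 * k) = log 4 + log k := Real.log_mul (by norm_num) hk0.ne'
  have hlogle : ∀ c, 0 < c → log w ≤ w / c + (log c - 1) := by
    intro c hc
    have := Real.log_le_sub_one_of_pos (show 0 < w / c by positivity)
    rw [Real.log_div (by positivity) hc.ne'] at this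
    linarith
  let f : ℝ → ℝ := fun t => k * (2 * log t - log (4 * k) + 0.025) - (log k + 5.48 + (t + 13) * log k / 2)
  have hconc : ConcaveOn ℝ (Set.Ioi 0) f := by
    have h1 : ConcaveOn ℝ (Set.Ioi 0) fun t => (2 * k) • log t :=
      strictConcaveOn_log_Ioi.concaveOn.smul (by positivity)
    have h3 : ConcaveOn ℝ (Set.Ioi 0) fun t : ℝ => (-(log k / 2)) * t +
        (k * (- log (4 * k) + 0.025) - (log k + 5.48 + 13 * log k / 2)) := by
      refine ⟨convex_Ioi 0, fun x _ y _ a b _ _ hab => le_of_eq ?_⟩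
      simp only [smul_eq_mul]
      linear_combination (k * (- log (4 * k) + 0.025) - (log k + 5.48 + 13 * log k / 2)) * hab
    refine (h1.add h3).congr fun x _ => ?_
    simp only [f, Pi.add_apply, smul_eq_mul]
    ring
  have hend : 0 < f k := by
    have h5 : 5.54 ≤ log k := by
      have : log 256 ≤ log k := Real.log_le_log (by norm_num) (by linarith)
      rw [show (256 : ℝ) = 2 ^ 8 by norm_num, Real.log_pow] at this
      push_cast at this
      linarith
    simp only [f, h4k]
    nlinarith
  suffices h : ∃ t₀, 0 < t₀ ∧ t₀ ≤ t ∧ 0 < f t₀ by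
    obtain ⟨t₀, h0, ht0, hf⟩ := h
    have := hconc.min_le_of_mem_Icc (Set.mem_Ioi.2 h0) (Set.mem_Ioi.2 hk0) ⟨ht0, htk⟩
    have := (lt_min hf hend).trans_le this
    simp only [f] at this
    linarith
  rcases ht with ht | ⟨hk', ht⟩
  · refine ⟨3 * w, by positivity, ht, ?_⟩
    have h94 : log (3 * w) = log 3 + log w := Real.log_mul (by norm_num) (by positivity)
    have h32 : 1 / 3 ≤ log 3 - log 2 := by
      rw [← Real.log_div (by norm_num) (by norm_num)]
      have := Real.one_sub_inv_le_log_of_pos (show (0 : ℝ) < 3 / 2 by norm_num)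
      norm_num at this ⊢
      exact this
    have hlw := hlogle 20 (by norm_num)
    have h20 : log 20 ≤ 3.03 := by
      have := Real.log_le_sub_one_of_pos (show (0 : ℝ) < 20 / 16 by norm_num)
      rw [Real.log_div (by norm_num) (by norm_num), show (16 : ℝ) = 2 ^ 4 by norm_num,
        Real.log_pow] at this
      push_cast at this
      norm_num at this ⊢
      linarith
    simp only [f, h94, h4k, hLw, h4]
    rw [← hw2]
    have e1 : w ^ 2 * (2 / 3 + 0.025) ≤ w ^ 2 * (2 * (log 3 - log 2) + 0.025) := by
      gcongr; linarith
    have e2 : (3 * w + 15) * log w ≤ (3 * w + 15) * (w / 20 + 2.03) := by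
      gcongr; linarith
    nlinarith
  · refine ⟨2 * w, by positivity, ht, ?_⟩
    have h94 : log (2 * w) = log 2 + log w := Real.log_mul (by norm_num) (by positivity)
    have hw1 : 574 ≤ w := by rw [hw, Real.le_sqrt (by norm_num) hk0.le]; linarith
    have hlw := hlogle 574 (by norm_num)
    have h20 : log 574 ≤ 6.36 := by
      have := Real.log_le_sub_one_of_pos (show (0 : ℝ) < 574 / 512 by norm_num)
      rw [Real.log_div (by norm_num) (by norm_num), show (512 : ℝ) = 2 ^ 9 by norm_num,
        Real.log_pow] at this
      push_cast at this
      norm_num at this ⊢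
      linarith
    simp only [f, h94, h4k, hLw, h4]
    rw [← hw2]
    have e2 : (2 * w + 15) * log w ≤ (2 * w + 15) * (w / 574 + 5.36) := by
      gcongr; linarith
    nlinarith

theorem Nat.primorial_mul_pow_lt_choose {n k : ℕ} (hk : 400 ≤ k) (hn : n ≤ k ^ 2)
    (h : 9 * k ≤ n ∨ 330000 ≤ k ∧ 4 * k ≤ n) :
    primorial (2 * k + 2) * n ^ Nat.primeCounting n.sqrt < n.choose k := by
  by_contra! hC
  have hkn : 4 * k ≤ n := by omega
  set s := Nat.primeCounting n.sqrt
  have hs := Nat.four_mul_primeCounting_le n.sqrt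
  have hprod : n ^ k * 256 ^ k * 25 ^ (2 * k + 2) ≤
      76 ^ (2 * k + 2) * n ^ s * (4 * k) ^ k * (4 * k) * 27 ^ k := by
    calc n ^ k * 256 ^ k * 25 ^ (2 * k + 2)
        ≤ n ^ k * (4 * k * (4 * k).choose k * 27 ^ k) * 25 ^ (2 * k + 2) := by
          gcongr; exact Nat.pow_le_choose_four_mul k (by omega)
      _ = (4 * k).choose k * n ^ k * (4 * k * 27 ^ k * 25 ^ (2 * k + 2)) := by ring
      _ ≤ n.choose k * (4 * k) ^ k * (4 * k * 27 ^ k * 25 ^ (2 * k + 2)) := by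
          gcongr ?_ * _; exact Nat.choose_mul_pow_le_choose_mul_pow hkn k
      _ ≤ primorial (2 * k + 2) * n ^ s * (4 * k) ^ k *
            (4 * k * 27 ^ k * 25 ^ (2 * k + 2)) := by gcongr
      _ = 25 ^ (2 * k + 2) * primorial (2 * k + 2) * (n ^ s * (4 * k) ^ k *
            (4 * k) * 27 ^ k) := by ring
      _ ≤ 76 ^ (2 * k + 2) * (n ^ s * (4 * k) ^ k * (4 * k) * 27 ^ k) := by
          gcongr ?_ * _; exact primorial_le_pow _
      _ = _ := by ring
  have hn0 : (0 : ℝ) < n := by exact_mod_cast (show 0 < n by omega)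
  have hk0 : (0 : ℝ) < k := by exact_mod_cast (show 0 < k by omega)
  have hprod' := Nat.cast_le (α := ℝ).2 hprod
  push_cast at hprod'
  have hlog := Real.log_le_log (by positivity) hprod'
  rw [Real.log_mul (by positivity) (by positivity), Real.log_mul (by positivity) (by positivity),
    Real.log_mul (by positivity) (by positivity), Real.log_mul (by positivity) (by positivity),
    Real.log_mul (by positivity) (by positivity), Real.log_mul (by positivity) (by positivity)]
    at hlog
  simp only [Real.log_pow] at hlog
  push_cast at hlog
  have h2 := Real.log_two_lt_d9
  have h4 : Real.log 4 = 2 * Real.log 2 := by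
    rw [show (4 : ℝ) = 2 ^ 2 by norm_num, Real.log_pow]; norm_num
  have h4k : Real.log (4 * k) = Real.log 4 + Real.log k :=
    Real.log_mul (by norm_num) hk0.ne'
  have hconst : 0.025 ≤ Real.log 256 + 2 * Real.log 25 - 2 * Real.log 76 - Real.log 27 := by
    have := Real.one_sub_inv_le_log_of_pos
      (show (0 : ℝ) < 256 * 25 ^ 2 / (76 ^ 2 * 27) by norm_num)
    rw [Real.log_div (by norm_num) (by norm_num), Real.log_mul (by norm_num) (by norm_num),
      Real.log_mul (by norm_num) (by norm_num), Real.log_pow, Real.log_pow] at this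
    norm_num at this ⊢
    linarith
  have h76 : Real.log 76 - Real.log 25 ≤ 2.04 := by
    rw [← Real.log_div (by norm_num) (by norm_num)]
    refine (Real.log_le_sub_one_of_pos (by norm_num)).trans (by norm_num)
  have hlogn : Real.log n ≤ 2 * Real.log k := by
    have := Real.log_le_log hn0 (show (n : ℝ) ≤ (k : ℝ) ^ 2 by exact_mod_cast hn)
    rw [Real.log_pow] at this
    exact_mod_cast this
  have hst : 4 * (s : ℝ) ≤ √n + 13 := by
    have h1 : (4 * s : ℝ) ≤ n.sqrt + 13 := by exact_mod_cast hs
    have h3 := Real.nat_sqrt_le_real_sqrt (a := n)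
    linarith
  have hkey := Real.sqrt_add_mul_log_lt (k := k) (t := √n) (by exact_mod_cast hk)
    (Real.sqrt_le_iff.2 ⟨hk0.le, by exact_mod_cast hn⟩) (by
      rcases h with h | ⟨h, h'⟩
      · left
        rw [show (3 : ℝ) = √9 by rw [show (9 : ℝ) = 3 ^ 2 by norm_num]; simp,
          ← Real.sqrt_mul (by norm_num)]
        exact Real.sqrt_le_sqrt (by exact_mod_cast h)
      · refine Or.inr ⟨by exact_mod_cast h, ?_⟩
        rw [show (2 : ℝ) = √4 by rw [show (4 : ℝ) = 2 ^ 2 by norm_num]; simp,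
          ← Real.sqrt_mul (by norm_num)]
        exact Real.sqrt_le_sqrt (by exact_mod_cast h'))
  have hlt : Real.log n = 2 * Real.log √n := by
    rw [Real.log_sqrt hn0.le]; ring
  rw [← hlt] at hkey
  have hLk : 0 ≤ Real.log k := Real.log_nonneg (by exact_mod_cast (show 1 ≤ k by omega))
  have e1 : (s : ℝ) * Real.log n ≤ (√n + 13) * Real.log k / 2 := by
    calc (s : ℝ) * Real.log n ≤ s * (2 * Real.log k) := by gcongr
      _ = (4 * s) * Real.log k / 2 := by ring
      _ ≤ _ := by gcongr
  have e2 := mul_le_mul_of_nonneg_left hconst hk0.le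
  nlinarith

theorem Nat.exists_prime_gt_two_mul_add_two {n k : ℕ} (hk : 400 ≤ k)
    (h : 9 * k ≤ n ∨ 330000 ≤ k ∧ 4 * k ≤ n) :
    ∃ p, p.Prime ∧ 2 * k + 2 < p ∧ ∃ j < k, p ∣ n - j := by
  by_cases hn : n ≤ k ^ 2
  · by_contra! hcon
    refine (Nat.primorial_mul_pow_lt_choose hk hn h).not_ge
      (Nat.choose_le_primorial_mul_pow (by omega) (by omega) fun p hp hd => ?_)
    by_contra hlt
    obtain ⟨j, hj, hdj⟩ := hp.exists_dvd_sub_of_dvd_choose hd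
    exact hcon p hp (by omega) j hj hdj
  · refine Nat.exists_prime_gt_two_mul_of_lt_choose (by omega) (by omega) ?_
    have h1 := Nat.choose_mul_pow_le_choose_mul_pow (show k ≤ n by omega) k
    rw [Nat.choose_self, one_mul] at h1
    have h2 := Nat.four_mul_primeCounting_add_le (x := 2 * k + 2) (by omega)
    set s := Nat.primeCounting (2 * k + 2)
    refine Nat.lt_of_mul_lt_mul_right (a := k ^ k) (lt_of_lt_of_le ?_ h1)
    refine lt_of_pow_lt_pow_left₀ 2 (by positivity) ?_
    calc (n ^ s * k ^ k) ^ 2 = n ^ (2 * s) * (k ^ 2) ^ k := by ring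
      _ ≤ n ^ (2 * s) * n ^ k := by gcongr; omega
      _ = n ^ (2 * s + k) := by ring
      _ < n ^ (2 * k) := Nat.pow_lt_pow_right (by omega) (by omega)
      _ = (n ^ k) ^ 2 := by ring

/-- A Sylvester-type theorem: among `k` consecutive integers ending in `n` there is a multiple of
a prime exceeding `2 * k`, unless one of them is itself a prime. -/
theorem Nat.exists_prime_mem_Ioc_or_exists_prime_gt_two_mul {n k : ℕ} (hn : 1000 ≤ n)
    (hk : 6 ≤ k) : (∃ p, p.Prime ∧ p ≤ n ∧ n < p + k) ∨
      ∃ p, p.Prime ∧ 2 * k < p ∧ ∃ j < k, p ∣ n - j := by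
  by_cases h9 : 9 * k ≤ n
  · right
    by_cases hk4 : k < 400
    · exact Nat.exists_prime_gt_two_mul_of_lt_four_hundred hn hk hk4 h9
    · obtain ⟨p, hp, hlt, h⟩ := Nat.exists_prime_gt_two_mul_add_two (by omega) (.inl h9)
      exact ⟨p, hp, by omega, h⟩
  by_cases hn' : n < 2970000
  · obtain ⟨p, hp, hpn, h⟩ := Nat.exists_prime_lt_nine_mul hn hn'
    exact .inl ⟨p, hp, hpn, by omega⟩
  by_cases h4 : 4 * k ≤ n
  · obtain ⟨p, hp, hlt, h⟩ := Nat.exists_prime_gt_two_mul_add_two (n := n) (k := k) (by omega)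
      (.inr ⟨by omega, h4⟩)
    exact .inr ⟨p, hp, by omega, h⟩
  · obtain ⟨p, hp, hlt, j, hj, m, hm⟩ := Nat.exists_prime_gt_two_mul_add_two (n := n)
      (k := (n - 1) / 4) (by omega) (.inr ⟨by omega, by omega⟩)
    have hm1 : m = 1 := by
      have h0 : m ≠ 0 := by rintro rfl; omega
      have : m < 2 := by
        by_contra! h2
        have := Nat.mul_le_mul_left p h2
        omega
      omega
    subst hm1
    exact .inl ⟨p, hp, by omega, by omega⟩

theorem He_add_two (n : ℕ) : He (n + 2) = X * He (n + 1) - C ((n : ℤ) + 1) * He n := by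
  rw [He]

theorem derivative_He_succ (n : ℕ) : derivative (He (n + 1)) = C ((n : ℤ) + 1) * He n := by
  induction n using Nat.twoStepInduction with
  | zero => simp [He]
  | one => simp [He]; norm_num [← two_mul]
  | more n ih1 ih2 =>
    rw [He_add_two (n + 1), derivative_sub, derivative_mul, derivative_C_mul, ih1, ih2,
      He_add_two]
    simp only [derivative_X, map_add, map_natCast, map_one]
    push_cast
    ring

theorem derivative_He (n : ℕ) : derivative (He n) = X * He n - He (n + 1) := by
  cases n with
  | zero => simp [He]
  | succ n => rw [derivative_He_succ, He_add_two]; ring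

theorem monic_natDegree_He (n : ℕ) : (He n).Monic ∧ (He n).natDegree = n := by
  induction n using Nat.twoStepInduction with
  | zero => simp [He]
  | one => simp [He, monic_X]
  | more n ih1 ih2 =>
    have h1 : (X * He (n + 1)).Monic := monic_X.mul ih2.1
    have h2 : (X * He (n + 1)).natDegree = n + 2 := by
      rw [natDegree_X_mul ih2.1.ne_zero, ih2.2]
    have h3 : (C ((n : ℤ) + 1) * He n).natDegree < (X * He (n + 1)).natDegree := by
      rw [h2]
      exact (natDegree_C_mul_le _ _).trans_lt (by omega)
    rw [He_add_two]
    exact ⟨h1.sub_of_left (degree_lt_degree h3), (natDegree_sub_eq_left_of_natDegree_lt h3).trans h2⟩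

theorem coeff_zero_He_mul_He_succ (n : ℕ) : (He n).coeff 0 * (He (n + 1)).coeff 0 = 0 := by
  induction n with
  | zero => simp [He]
  | succ n ih =>
    rw [He_add_two]
    simp only [coeff_sub, mul_coeff_zero, coeff_X_zero, coeff_C_zero]
    linear_combination (-((n : ℤ) + 1)) * ih

/-- The Wronskian of two consecutive Hermite polynomials, with derivatives eliminated. -/
noncomputable def wronskHeSucc (n : ℕ) : ℤ[X] :=
  C ((n : ℤ) + 1) * He n ^ 2 - X * He n * He (n + 1) + He (n + 1) ^ 2

theorem wronskHe_degSeq_two (n : ℕ) : wronskHe (degSeq ![n, n]) = wronskHeSucc n := by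
  have h0 : degSeq ![n, n] 0 = n := by simp [degSeq]
  have h1 : degSeq ![n, n] 1 = n + 1 := by simp [degSeq]
  rw [wronskHe, Matrix.det_fin_two]
  simp only [Matrix.of_apply, h0, h1, Fin.val_zero, Fin.val_one, Function.iterate_zero, id_eq,
    Function.iterate_one, derivative_He_succ, derivative_He n, wronskHeSucc]
  ring

theorem wronskHeSucc_succ (n : ℕ) :
    wronskHeSucc (n + 1) = He (n + 1) ^ 2 + C ((n : ℤ) + 1) * wronskHeSucc n := by
  rw [wronskHeSucc, wronskHeSucc, He_add_two]
  simp only [map_add, map_natCast, map_one]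
  push_cast
  ring

theorem monic_natDegree_wronskHeSucc (n : ℕ) :
    (wronskHeSucc n).Monic ∧ (wronskHeSucc n).natDegree = 2 * n := by
  induction n with
  | zero =>
    have : wronskHeSucc 0 = 1 := by simp [wronskHeSucc, He]; ring
    simp [this]
  | succ n ih =>
    have h1 := (monic_natDegree_He (n + 1)).1.pow 2
    have h2 : (He (n + 1) ^ 2).natDegree = 2 * (n + 1) := by
      rw [natDegree_pow, (monic_natDegree_He (n + 1)).2]
    have h3 : (C ((n : ℤ) + 1) * wronskHeSucc n).natDegree < (He (n + 1) ^ 2).natDegree := by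
      rw [h2]
      exact (natDegree_C_mul_le _ _).trans_lt (by omega)
    rw [wronskHeSucc_succ]
    exact ⟨h1.add_of_left (degree_lt_degree h3),
      (natDegree_add_eq_left_of_natDegree_lt h3).trans h2⟩

theorem derivative_wronskHeSucc (n : ℕ) :
    derivative (wronskHeSucc n) = X * wronskHeSucc n - He n * He (n + 1) := by
  simp only [wronskHeSucc, derivative_add, derivative_sub, derivative_mul, derivative_C,
    derivative_X, derivative_pow, derivative_He_succ, derivative_He n]
  simp only [Nat.cast_ofNat, map_ofNat]
  ring

theorem derivative_derivative_wronskHeSucc (n : ℕ) :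
    derivative (derivative (wronskHeSucc n)) = X * derivative (wronskHeSucc n) +
      2 * wronskHeSucc n - 2 * C ((n : ℤ) + 1) * He n ^ 2 := by
  rw [derivative_wronskHeSucc, derivative_sub, derivative_mul, derivative_mul,
    derivative_wronskHeSucc, derivative_He_succ, derivative_He n, derivative_X]
  simp only [wronskHeSucc]
  ring

theorem wronskHeSucc_differential_equation (n : ℕ) :
    derivative (derivative (derivative (wronskHeSucc n))) -
      3 * (X * derivative (derivative (wronskHeSucc n))) +
      2 * (X * (X * derivative (wronskHeSucc n))) +
      C (4 * (n : ℤ) + 1) * derivative (wronskHeSucc n) -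
      C (4 * (n : ℤ)) * (X * wronskHeSucc n) = 0 := by
  rw [derivative_derivative_wronskHeSucc]
  simp only [derivative_wronskHeSucc, derivative_add,
    derivative_sub, derivative_mul, derivative_C, derivative_X, derivative_pow,
    derivative_He_succ, derivative_He n, derivative_ofNat]
  simp only [wronskHeSucc, Nat.cast_ofNat, map_ofNat, map_add, map_mul, map_natCast, map_one]
  ring

theorem coeff_wronskHeSucc_rec (n j : ℕ) :
    ((j : ℤ) + 4) * (j + 3) * (j + 2) * (wronskHeSucc n).coeff (j + 4) =
      (4 * n - 2 * j) * (wronskHeSucc n).coeff j -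
        (j + 2) * (4 * n - 2 - 3 * j) * (wronskHeSucc n).coeff (j + 2) := by
  have h := congrArg (coeff · (j + 1)) (wronskHeSucc_differential_equation n)
  have h3 : (3 : ℤ[X]) = C 3 := rfl
  have h2 : (2 : ℤ[X]) = C 2 := rfl
  simp only [coeff_add, coeff_sub, h2, h3, coeff_C_mul, coeff_X_mul, coeff_derivative,
    coeff_zero] at h
  rcases j with - | j
  · simp only [coeff_X_mul_zero] at h
    push_cast at h ⊢
    linear_combination h
  · simp only [coeff_X_mul, coeff_derivative] at h
    push_cast at h ⊢
    linear_combination h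

theorem coeff_zero_wronskHeSucc_dvd (n i : ℕ) :
    (wronskHeSucc n).coeff 0 ∣ (i.factorial : ℤ) * (wronskHeSucc n).coeff i := by
  have hαβ := coeff_zero_He_mul_He_succ n
  have h1 : (wronskHeSucc n).coeff 1 = 0 := by
    have h := congrArg (coeff · 0) (derivative_wronskHeSucc n)
    simp only [coeff_derivative, coeff_sub, mul_coeff_zero, coeff_X_zero, hαβ] at h
    simpa using h
  have h2 : (wronskHeSucc n).coeff 0 ∣ 2 * (wronskHeSucc n).coeff 2 := by
    have h := congrArg (coeff · 0) (derivative_derivative_wronskHeSucc n)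
    have h2 : (2 : ℤ[X]) = C 2 := rfl
    have h0 : (wronskHeSucc n).coeff 0 =
        (n + 1) * (He n).coeff 0 ^ 2 + (He (n + 1)).coeff 0 ^ 2 := by
      simp [wronskHeSucc, mul_coeff_zero, pow_two]
    simp only [coeff_derivative, coeff_sub, coeff_add, mul_coeff_zero, coeff_X_zero, h2,
      coeff_C_zero, pow_two, zero_add] at h
    norm_num at h
    rcases mul_eq_zero.1 hαβ with hα | hβ
    · rw [hα] at h
      exact ⟨2, by linear_combination h⟩
    · rw [hβ] at h0
      exact ⟨0, by linear_combination h + 2 * h0⟩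
  have h3 : (wronskHeSucc n).coeff 3 = 0 := by
    have h := congrArg (coeff · 0) (wronskHeSucc_differential_equation n)
    have h3 : (3 : ℤ[X]) = C 3 := rfl
    have h2 : (2 : ℤ[X]) = C 2 := rfl
    simp only [coeff_add, coeff_sub, h2, h3, coeff_C_mul, coeff_X_mul_zero, coeff_derivative,
      coeff_zero, zero_add, h1] at h
    norm_num at h
    exact h
  induction i using Nat.strong_induction_on with
  | _ i ih =>
    match i, ih with
    | 0, _ => simp
    | 1, _ => simp [h1]
    | 2, _ => simpa using h2
    | 3, _ => simp [h3]
    | j + 4, ih =>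
      have e : ((j + 4).factorial : ℤ) * (wronskHeSucc n).coeff (j + 4) =
          ((j : ℤ) + 1) * (4 * n - 2 * j) * (j.factorial * (wronskHeSucc n).coeff j) -
            (4 * n - 2 - 3 * j) * ((j + 2).factorial * (wronskHeSucc n).coeff (j + 2)) := by
        have := coeff_wronskHeSucc_rec n j
        simp only [Nat.factorial_succ]
        push_cast
        linear_combination ((j : ℤ) + 1) * (j.factorial : ℤ) * this
      rw [e]
      exact dvd_sub ((ih j (by omega)).mul_left _) ((ih (j + 2) (by omega)).mul_left _)

section ModPrime

variable {p : ℕ}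

theorem map_He_add {m : ℕ} (hm : p ∣ m) (j : ℕ) :
    (He (m + j)).map (Int.castRingHom (ZMod p)) =
      (He m).map (Int.castRingHom (ZMod p)) * (He j).map (Int.castRingHom (ZMod p)) := by
  have hm0 : (m : ZMod p) = 0 := (ZMod.natCast_eq_zero_iff _ _).2 hm
  induction j using Nat.twoStepInduction with
  | zero => simp [He]
  | one =>
    rcases m with - | m
    · simp [He]
    · rw [He_add_two]
      have : (Int.castRingHom (ZMod p)) ((m : ℤ) + 1) = 0 := by
        push_cast at hm0
        simpa using hm0
      simp only [Polynomial.map_sub, Polynomial.map_mul, map_X, map_C, this, He]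
      simp [mul_comm]
  | more j ih1 ih2 =>
    rw [← add_assoc, He_add_two, He_add_two]
    have : (Int.castRingHom (ZMod p)) (((m + j : ℕ) : ℤ) + 1) =
        (Int.castRingHom (ZMod p)) ((j : ℤ) + 1) := by
      simp [hm0]
    simp only [Polynomial.map_sub, Polynomial.map_mul, map_X, map_C, this, ih1,
      show m + j + 1 = m + (j + 1) by ring, ih2]
    ring

theorem coeff_zero_He_of_odd {n : ℕ} (hn : Odd n) : (He n).coeff 0 = 0 := by
  obtain ⟨k, rfl⟩ := hn
  induction k with
  | zero => simp [He]
  | succ k ih =>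
    rw [show 2 * (k + 1) + 1 = 2 * k + 1 + 2 by ring, He_add_two]
    simp [mul_coeff_zero, ih]

theorem map_He_prime (hp : p.Prime) (hodd : Odd p) :
    (He p).map (Int.castRingHom (ZMod p)) = X ^ p := by
  have := Fact.mk hp
  obtain ⟨hmon, hdeg⟩ := monic_natDegree_He p
  ext i
  rw [coeff_X_pow]
  rcases lt_trichotomy i p with h | rfl | h
  · rw [if_neg h.ne, coeff_map]
    rcases i with - | i
    · simp [coeff_zero_He_of_odd hodd]
    · obtain ⟨m, rfl⟩ := Nat.exists_eq_add_one_of_ne_zero hp.ne_zero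
      have hd := congrArg (coeff · i) (derivative_He_succ m)
      simp only [coeff_derivative, coeff_C_mul] at hd
      have hd' := congrArg (Int.castRingHom (ZMod (m + 1))) hd
      have hm0 : (Int.castRingHom (ZMod (m + 1))) ((m : ℤ) + 1) = 0 := by simp
      rw [map_mul, map_mul, hm0, zero_mul] at hd'
      refine (mul_eq_zero.1 hd').resolve_right fun hi => ?_
      have hi' : ((i + 1 : ℕ) : ZMod (m + 1)) = 0 := by simpa using hi
      rw [ZMod.natCast_eq_zero_iff] at hi'
      exact absurd (Nat.le_of_dvd (by omega) hi') (by omega)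
  · rw [if_pos rfl, coeff_map]
    have := hmon.coeff_natDegree
    rw [hdeg] at this
    simp [this]
  · rw [if_neg h.ne', coeff_map, coeff_eq_zero_of_natDegree_lt (by omega), map_zero]

theorem map_He_of_dvd (hp : p.Prime) (hodd : Odd p) {m : ℕ} (hm : p ∣ m) :
    (He m).map (Int.castRingHom (ZMod p)) = X ^ m := by
  obtain ⟨k, rfl⟩ := hm
  induction k with
  | zero => simp [He]
  | succ k ih =>
    rw [mul_add, mul_one, map_He_add (Dvd.intro _ rfl), ih, map_He_prime hp hodd, pow_add]

theorem map_wronskHeSucc_add (hp : p.Prime) (hodd : Odd p) {m : ℕ} (hm : p ∣ m) (r : ℕ) :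
    (wronskHeSucc (m + r)).map (Int.castRingHom (ZMod p)) =
      X ^ (2 * m) * (wronskHeSucc r).map (Int.castRingHom (ZMod p)) := by
  have hm0 : (m : ZMod p) = 0 := (ZMod.natCast_eq_zero_iff _ _).2 hm
  have : (Int.castRingHom (ZMod p)) (((m + r : ℕ) : ℤ) + 1) =
      (Int.castRingHom (ZMod p)) ((r : ℤ) + 1) := by
    simp [hm0]
  simp only [wronskHeSucc, Polynomial.map_add, Polynomial.map_sub, Polynomial.map_mul,
    Polynomial.map_pow, map_X, map_C, this, add_assoc m r 1, map_He_add hm,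
    map_He_of_dvd hp hodd hm]
  ring

theorem prime_dvd_coeff_zero_of_dvd_wronskHeSucc (hp : p.Prime) (hodd : Odd p) {m r : ℕ}
    (hm : p ∣ m) {g : ℤ[X]} (hg : g ∣ wronskHeSucc (m + r)) (hr : 2 * r < g.natDegree) :
    (p : ℤ) ∣ g.coeff 0 := by
  have := Fact.mk hp
  by_contra hnd
  set φ := Int.castRingHom (ZMod p)
  have hlead : IsUnit g.leadingCoeff := by
    obtain ⟨h, hh⟩ := hg
    have := (monic_natDegree_wronskHeSucc (m + r)).1.leadingCoeff
    rw [hh, leadingCoeff_mul] at this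
    exact IsUnit.of_mul_eq_one _ this
  have hdeg : (g.map φ).natDegree = g.natDegree :=
    natDegree_map_of_leadingCoeff_ne_zero _ (hlead.map φ).ne_zero
  have hX : IsCoprime (X : (ZMod p)[X]) (g.map φ) := by
    rw [irreducible_X.coprime_iff_not_dvd, X_dvd_iff, coeff_map]
    intro h0
    exact hnd ((ZMod.intCast_zmod_eq_zero_iff_dvd _ _).1 (by simpa [φ] using h0))
  have hdvd : g.map φ ∣ (wronskHeSucc r).map φ := by
    refine (hX.symm.pow_right (n := 2 * m)).dvd_of_dvd_mul_left ?_
    rw [← map_wronskHeSucc_add hp hodd hm]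
    exact Polynomial.map_dvd φ hg
  obtain ⟨hmon, hd⟩ := monic_natDegree_wronskHeSucc r
  have := natDegree_le_of_dvd hdvd (hmon.map φ).ne_zero
  rw [hdeg, hmon.natDegree_map, hd] at this
  omega

end ModPrime

/-- The largest index minimising `c * padicValInt p (f.coeff i) + i` over the support of `f`. -/
theorem Polynomial.exists_last_min_weight {f : ℤ[X]} (hf : f ≠ 0) (p c : ℕ) :
    ∃ j, f.coeff j ≠ 0 ∧ ∀ i, f.coeff i ≠ 0 →
      c * padicValInt p (f.coeff j) + j ≤ c * padicValInt p (f.coeff i) + i ∧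
      (j < i → c * padicValInt p (f.coeff j) + j < c * padicValInt p (f.coeff i) + i) := by
  set w : ℕ → ℕ := fun i => c * padicValInt p (f.coeff i) + i
  obtain ⟨i₀, hi₀, hmin⟩ := Finset.exists_min_image f.support w (by simpa using hf)
  obtain ⟨j, hj, hmax⟩ := Finset.exists_max_image (f.support.filter fun i => w i = w i₀) id
    ⟨i₀, by simp [mem_support_iff.1 hi₀]⟩
  rw [Finset.mem_filter, mem_support_iff] at hj
  refine ⟨j, hj.1, fun i hi => ?_⟩
  have h1 : w j ≤ w i := hj.2.trans_le (hmin i (mem_support_iff.2 hi))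
  refine ⟨h1, fun hji => lt_of_le_of_ne h1 fun heq => ?_⟩
  have := hmax i (Finset.mem_filter.2 ⟨mem_support_iff.2 hi, heq.symm.trans hj.2⟩)
  simp only [id_eq] at this
  omega

theorem Polynomial.not_dvd_coeff_zero_of_dvd_factorial_mul_coeff {p : ℕ} (hp : p.Prime)
    {g h : ℤ[X]} (h0 : (g * h).coeff 0 ≠ 0)
    (hdvd : ∀ i, (g * h).coeff 0 ∣ (i.factorial : ℤ) * (g * h).coeff i)
    (hlead : IsUnit g.leadingCoeff) (hdeg : 0 < g.natDegree) (hgp : g.natDegree < p) :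
    ¬ (p : ℤ) ∣ g.coeff 0 := by
  have := Fact.mk hp
  intro hpg
  have hgh0 := h0
  rw [mul_coeff_zero] at hgh0
  have hg0 : g.coeff 0 ≠ 0 := left_ne_zero_of_mul hgh0
  have hh0 : h.coeff 0 ≠ 0 := right_ne_zero_of_mul hgh0
  obtain ⟨j, hj, hjmin⟩ := exists_last_min_weight (f := g) (by rintro rfl; simp at hg0) p (p - 1)
  obtain ⟨k, hk, hkmin⟩ := exists_last_min_weight (f := h) (by rintro rfl; simp at hh0) p (p - 1)
  set v := padicValInt p
  have hp1 : 0 < p - 1 := by have := hp.two_le; omega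
  have hcoeff : ¬ (p : ℤ) ^ (v (g.coeff j) + v (h.coeff k) + 1) ∣ (g * h).coeff (j + k) := by
    rw [coeff_mul, ← Finset.add_sum_erase _ _
      (show (j, k) ∈ Finset.HasAntidiagonal.antidiagonal (j + k) by simp)]
    rw [dvd_add_left]
    · rw [padicValInt_dvd_iff, padicValInt.mul hj hk]
      simp [hj, hk, v]
    · refine Finset.dvd_sum fun ab hab => ?_
      obtain ⟨a, b⟩ := ab
      simp only [Finset.mem_erase, ne_eq, Prod.mk.injEq,
        Finset.HasAntidiagonal.mem_antidiagonal] at hab ⊢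
      by_cases ha : g.coeff a = 0
      · simp [ha]
      by_cases hb : h.coeff b = 0
      · simp [hb]
      rw [padicValInt_dvd_iff, padicValInt.mul ha hb]
      right
      have h1 := hjmin a ha
      have h2 := hkmin b hb
      have : (p - 1) * (v (g.coeff j) + v (h.coeff k)) <
          (p - 1) * (v (g.coeff a) + v (h.coeff b)) := by
        rw [mul_add, mul_add]
        omega
      exact Nat.lt_of_mul_lt_mul_left this
  have hW : (g * h).coeff (j + k) ≠ 0 := by
    intro h
    exact hcoeff (h ▸ dvd_zero _)
  have hv : v ((g * h).coeff (j + k)) ≤ v (g.coeff j) + v (h.coeff k) := by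
    by_contra! hlt
    exact hcoeff ((padicValInt_dvd_iff (p := p) _ _).2 (Or.inr hlt))
  have hv0 : v ((g * h).coeff 0) = v (g.coeff 0) + v (h.coeff 0) := by
    rw [mul_coeff_zero]; exact padicValInt.mul hg0 hh0
  have hfac : v (g.coeff 0) + v (h.coeff 0) ≤
      padicValNat p (j + k).factorial + v ((g * h).coeff (j + k)) := by
    have hf : (((j + k).factorial : ℕ) : ℤ) ≠ 0 := by exact_mod_cast Nat.factorial_ne_zero _
    have h1 := (padicValInt_dvd_iff (p := p) _ _).1 ((padicValInt_dvd _).trans (hdvd (j + k)))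
    rw [padicValInt.mul hf hW, padicValInt.of_nat] at h1
    rw [← hv0]
    exact h1.resolve_left (mul_ne_zero hf hW)
  have hjk : j + k = 0 := by
    by_contra hne
    have h1 := sub_one_mul_padicValNat_factorial_lt_of_ne_zero p hne
    have h2 := (hjmin 0 hg0).1
    have h3 := (hkmin 0 hh0).1
    have h4 := Nat.mul_le_mul_left (p - 1) (hfac.trans (Nat.add_le_add_left hv _))
    simp only [mul_add] at h4
    omega
  obtain ⟨rfl, rfl⟩ : j = 0 ∧ k = 0 := by omega
  have h1 := (hjmin g.natDegree (by simpa using hlead.ne_zero)).2 hdeg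
  have h2 : v (g.coeff g.natDegree) = 0 := by
    rcases Int.isUnit_iff.1 hlead with h | h <;> rw [coeff_natDegree, h] <;> simp [v, padicValInt]
  have h3 : 1 ≤ v (g.coeff 0) :=
    ((padicValInt_dvd_iff (p := p) 1 _).1 (by simpa using hpg)).resolve_left hg0
  have h4 := Nat.mul_le_mul_left (p - 1) h3
  rw [h2] at h1
  omega

/-- Lemma `lem:nn_from_11_to_q`.  Let `n ≥ 1000` and let `q` be the
largest prime with `q ≤ n`.  Then `R_{n,n}` has no factor in `ℤ[X]` of degree `d` for
any `11 ≤ d ≤ q - 1`. -/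
theorem stmt14 (n : ℕ) (hn : 1000 ≤ n)
    (q : ℕ) (hq : q.Prime) (hqn : q ≤ n)
    (hqmax : ∀ q' : ℕ, q'.Prime → q' ≤ n → q' ≤ q)
    (HeL RL : Polynomial ℤ)
    (hHe : Polynomial.C (vand (degSeq ![n, n])) * HeL = wronskHe (degSeq ![n, n]))
    (hR : HeL = Polynomial.X ^ sStat (degSeq ![n, n]) * RL)
    (hR0 : RL.coeff 0 ≠ 0) :
    ∀ d : ℕ, 11 ≤ d → d ≤ q - 1 →
      ¬ ∃ g : Polynomial ℤ, g.natDegree = d ∧ g ∣ RL := by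
  have hd0 : degSeq ![n, n] 0 = n := by simp [degSeq]
  have hd1 : degSeq ![n, n] 1 = n + 1 := by simp [degSeq]
  have hv : vand (degSeq ![n, n]) = 1 := by
    have hI0 : Finset.Iio (0 : Fin 2) = ∅ := rfl
    have hI1 : Finset.Iio (1 : Fin 2) = {0} := rfl
    simp [vand, Fin.prod_univ_two, hd0, hd1, hI0, hI1]
  have hs : sStat (degSeq ![n, n]) = 0 := by
    have : dStat (degSeq ![n, n]) = 0 := by
      rw [dStat, Finset.card_filter, Finset.card_filter, Fin.sum_univ_two, Fin.sum_univ_two,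
        hd0, hd1]
      rcases Nat.even_or_odd n with h | h
      · simp only [h, h.add_one, Nat.not_odd_iff_even.2 h, Nat.not_even_iff_odd.2 h.add_one,
          if_true, if_false]
        norm_num
      · simp only [h, h.add_one, Nat.not_even_iff_odd.2 h, Nat.not_odd_iff_even.2 h.add_one,
          if_true, if_false]
        norm_num
    simp [sStat, this]
  have hRW : RL = wronskHeSucc n := by
    rw [hv, map_one, one_mul, wronskHe_degSeq_two] at hHe
    rw [hs, pow_zero, one_mul] at hR
    rw [← hR, hHe]
  rintro d hd hdq ⟨g, hgd, hg⟩
  obtain ⟨p, j, hp, hdp, hjn, hjd, hpj⟩ :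
      ∃ p j, p.Prime ∧ d < p ∧ j ≤ n ∧ 2 * j < d ∧ p ∣ n - j := by
    rcases Nat.exists_prime_mem_Ioc_or_exists_prime_gt_two_mul hn
      (show 6 ≤ (d - 1) / 2 + 1 by omega) with ⟨p, hp, hpn, hlt⟩ | ⟨p, hp, hlt, j, hj, hpj⟩
    · have := hqmax p hp hpn
      refine ⟨q, n - q, hq, by omega, by omega, by omega, ?_⟩
      rw [Nat.sub_sub_self hqn]
    · exact ⟨p, j, hp, by omega, by omega, by omega, hpj⟩
  rw [hRW] at hg hR0
  obtain ⟨h, hgh⟩ := hg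
  have hlead : IsUnit g.leadingCoeff := by
    have := (monic_natDegree_wronskHeSucc n).1.leadingCoeff
    rw [hgh, leadingCoeff_mul] at this
    exact IsUnit.of_mul_eq_one _ this
  refine Polynomial.not_dvd_coeff_zero_of_dvd_factorial_mul_coeff hp (hgh ▸ hR0)
    (fun i => hgh ▸ coeff_zero_wronskHeSucc_dvd n i) hlead (by omega) (by omega) ?_
  refine prime_dvd_coeff_zero_of_dvd_wronskHeSucc hp (hp.odd_of_ne_two (by omega)) hpj
    (r := j) ?_ (by omega)
  rw [Nat.sub_add_cancel hjn, hgh]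
  exact Dvd.intro _ rfl
end

section
/- For every integer n ≥ 1, the constant term of the Wronskian Hermite polynomial He_{n,n} is given by He_{n,n}(0) = n!² / (2^{n−1} · ((n−1)/2)!²) if n is odd, and He_{n,n}(0) = (n+1) · n!² / (2^{n} · (n/2)!²) if n is even. In particular, He_{n,n}(0) is a perfect square when n is odd, and equals (n+1) times a perfect square when n is even. -/
open Polynomial Finset

theorem coeff_zero_He_add_two (n : ℕ) :
    (He (n + 2)).coeff 0 = -((n : ℤ) + 1) * (He n).coeff 0 := by
  rw [He, coeff_sub, mul_coeff_zero, coeff_X_zero, coeff_C_mul]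
  ring

theorem coeff_zero_He_odd (k : ℕ) : (He (2 * k + 1)).coeff 0 = 0 := by
  induction k with
  | zero => simp [He]
  | succ k ih =>
    rw [show 2 * (k + 1) + 1 = 2 * k + 1 + 2 by ring, coeff_zero_He_add_two, ih, mul_zero]

theorem two_pow_mul_factorial_mul_coeff_zero_He_even (k : ℕ) :
    2 ^ k * (k.factorial : ℤ) * (He (2 * k)).coeff 0 = (-1) ^ k * ((2 * k).factorial : ℤ) := by
  induction k with
  | zero => simp [He]
  | succ k ih =>
    rw [show 2 * (k + 1) = 2 * k + 1 + 1 by ring, coeff_zero_He_add_two]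
    simp only [Nat.factorial_succ]
    push_cast
    linear_combination (-(2 * (k : ℤ) + 1) * 2 * (k + 1)) * ih

theorem two_pow_mul_factorial_sq_mul_coeff_zero_He_even_sq (k : ℕ) :
    2 ^ (2 * k) * (k.factorial : ℤ) ^ 2 * (He (2 * k)).coeff 0 ^ 2 =
      ((2 * k).factorial : ℤ) ^ 2 := by
  have h := congrArg (· ^ 2) (two_pow_mul_factorial_mul_coeff_zero_He_even k)
  simp only [mul_pow, ← pow_mul] at h
  rwa [mul_comm k 2, pow_mul (-1 : ℤ), neg_one_sq, one_pow, one_mul] at h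

theorem vand_degSeq_pair (n : ℕ) : vand (degSeq ![n, n]) = 1 := by
  have h₀ : Finset.Iio (0 : Fin 2) = ∅ := by decide
  have h₁ : Finset.Iio (1 : Fin 2) = {0} := by decide
  simp [vand, degSeq, Fin.prod_univ_two, h₀, h₁]

theorem wronskHe_degSeq_pair (n : ℕ) :
    wronskHe (degSeq ![n, n]) =
      He n * derivative (He (n + 1)) - He (n + 1) * derivative (He n) := by
  simp [wronskHe, degSeq, Matrix.det_fin_two]

/-- Lemma `lem:nn_last_coeff`.  For `n ≥ 1`, the constant term of
`He_{n,n}` is `n!²/(2^{n-1}·((n-1)/2)!²)` if `n` is odd and `(n+1)·n!²/(2^n·(n/2)!²)` if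
`n` is even; in particular it is a perfect square for `n` odd and `(n+1)` times a
perfect square for `n` even.  (The divisions are stated multiplied out.) -/
theorem stmt15 (n : ℕ) (hn : 1 ≤ n)
    (HeL : Polynomial ℤ)
    (hHe : Polynomial.C (vand (degSeq ![n, n])) * HeL = wronskHe (degSeq ![n, n])) :
    (Odd n →
      (2 : ℤ) ^ (n - 1) * ((Nat.factorial ((n - 1) / 2) : ℤ)) ^ 2 * HeL.coeff 0
          = ((Nat.factorial n : ℤ)) ^ 2 ∧
      ∃ r : ℤ, HeL.coeff 0 = r ^ 2) ∧
    (Even n →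
      (2 : ℤ) ^ n * ((Nat.factorial (n / 2) : ℤ)) ^ 2 * HeL.coeff 0
          = ((n : ℤ) + 1) * ((Nat.factorial n : ℤ)) ^ 2 ∧
      ∃ r : ℤ, HeL.coeff 0 = ((n : ℤ) + 1) * r ^ 2) := by
  rw [vand_degSeq_pair, map_one, one_mul, wronskHe_degSeq_pair, derivative_He_succ] at hHe
  subst hHe
  constructor
  · rintro ⟨k, rfl⟩
    rw [derivative_He_succ, show 2 * k + 1 - 1 = 2 * k by omega, Nat.mul_div_cancel_left k two_pos]
    have h := two_pow_mul_factorial_sq_mul_coeff_zero_He_even_sq k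
    have hc : (C (((2 * k + 1 : ℕ) : ℤ) + 1) * He (2 * k + 1)).coeff 0 = 0 := by
      rw [coeff_C_mul, coeff_zero_He_odd, mul_zero]
    rw [coeff_sub, mul_coeff_zero, hc, mul_coeff_zero, coeff_zero_He_add_two, coeff_C_mul,
      Nat.factorial_succ]
    push_cast
    exact ⟨by linear_combination (2 * (k : ℤ) + 1) ^ 2 * h,
      (2 * (k : ℤ) + 1) * (He (2 * k)).coeff 0, by ring⟩
  · intro he
    obtain ⟨k, rfl⟩ := even_iff_two_dvd.mp he
    rw [Nat.mul_div_cancel_left k two_pos]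
    have h := two_pow_mul_factorial_sq_mul_coeff_zero_He_even_sq k
    rw [coeff_sub, mul_coeff_zero (He (2 * k)), coeff_C_mul, mul_coeff_zero (He (2 * k + 1)),
      coeff_zero_He_odd]
    push_cast
    exact ⟨by linear_combination (2 * (k : ℤ) + 1) * h, (He (2 * k)).coeff 0, by ring⟩
end

section
/- Let n ≥ 3 be odd and write R_{n,2}(x) = Σ_{i=0}^{n+1} a_i x^i (so deg R_{n,2} = n+1 since s_{(n,2)} = 1). If 3 divides n + 1, then ν_3(a_0) − ν_3(a_j) < j/2 for every 1 ≤ j ≤ n+1; if 3 does not divide n + 1, then ν_3(a_0) − ν_3(a_j) ≤ j/2 for every 1 ≤ j ≤ n+1 with equality for some j. Equivalently, the slope of the right-most edge of the Newton polygon of R_{n,2} with respect to the prime 3 is strictly less than 1/2 if 3 | n+1, and equal to 1/2 otherwise. -/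
open Polynomial Finset

theorem He_eq_hermite (n : ℕ) : He n = hermite n := by
  induction n with
  | zero => simp [He]
  | succ n ih =>
    rw [hermite_succ, ← ih]
    cases n with
    | zero => simp [He]
    | succ k => rw [derivative_He_succ, He]

theorem coeff_He_of_odd {m j : ℕ} (hj : Odd j) : (He (2 * m)).coeff j = 0 := by
  rw [He_eq_hermite]
  exact coeff_hermite_of_odd_add (by grind)

/-- The coefficient form of the Hermite differential equation. -/
theorem coeff_He_add_two (n k : ℕ) :
    ((k : ℤ) + 2) * (k + 1) * (He n).coeff (k + 2) = ((k : ℤ) - n) * (He n).coeff k := by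
  have ode : derivative (derivative (He n)) - X * derivative (He n) + C (n : ℤ) * He n = 0 := by
    match n with
    | 0 => simp [He]
    | 1 => simp [He]
    | k + 2 =>
      rw [derivative_He_succ, derivative_C_mul, derivative_He_succ, He]
      push_cast
      simp only [map_add, map_natCast, map_one, map_ofNat]
      ring
  have h := congrArg (fun q : ℤ[X] => q.coeff k) ode
  cases k with
  | zero =>
    simp [coeff_derivative] at h ⊢
    linarith
  | succ k =>
    simp [coeff_derivative] at h ⊢
    linarith

theorem coeff_He_two_mul (m k : ℕ) :
    (He (2 * m)).coeff (2 * k) * ((2 * k).factorial : ℤ) =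
      (-1) ^ k * (2 ^ k * (k.factorial * m.choose k)) * (He (2 * m)).coeff 0 := by
  induction k with
  | zero => simp
  | succ k ih =>
    have hrec := coeff_He_add_two (2 * m) (2 * k)
    have hch : (m.choose (k + 1) : ℤ) * (k + 1) = m.choose k * (m - k) := by
      rcases le_or_gt k m with h | h
      · have := Nat.choose_succ_right_eq m k
        zify [h] at this
        exact this
      · simp [Nat.choose_eq_zero_of_lt h, Nat.choose_eq_zero_of_lt (Nat.lt_succ_of_lt h)]
    have hf : ((2 * (k + 1)).factorial : ℤ) = (2 * k + 2) * (2 * k + 1) * (2 * k).factorial := by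
      rw [show 2 * (k + 1) = 2 * k + 1 + 1 by ring, Nat.factorial_succ, Nat.factorial_succ]
      push_cast
      ring
    rw [hf, Nat.factorial_succ, show 2 * (k + 1) = 2 * k + 2 by ring]
    push_cast at hrec ⊢
    linear_combination ((2 * k).factorial : ℤ) * hrec + (2 * (k : ℤ) - 2 * m) * ih +
      (2 * (-1) ^ k * 2 ^ k * (k.factorial : ℤ) * (He (2 * m)).coeff 0) * hch

theorem vand_pair (a b : ℕ) : vand ![a, b] = (b : ℤ) - a := by
  simp [vand, Fin.prod_univ_two, show Iio (1 : Fin 2) = {0} by decide,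
    show Iio (0 : Fin 2) = ∅ by decide]

theorem wronskHe_pair (a b : ℕ) :
    wronskHe ![a, b] = He a * derivative (He b) - He b * derivative (He a) := by
  simp [wronskHe, Matrix.det_fin_two]

theorem degSeq_pair (a b : ℕ) : degSeq ![a, b] = ![b, a + 1] := by
  funext i
  fin_cases i <;> simp [degSeq, Fin.rev]

theorem sStat_pair_even {a b : ℕ} (ha : Even a) (hb : Even b) : sStat ![a, b] = 1 := by
  have h1 : (univ.filter fun i : Fin 2 => Odd (![a, b] i)) = ∅ := by
    ext i; fin_cases i <;> simp [ha, hb]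
  have h2 : (univ.filter fun i : Fin 2 => Even (![a, b] i)) = univ := by
    ext i; fin_cases i <;> simp [ha, hb]
  simp [sStat, dStat, h1, h2]

theorem coeff_wronskian_two (H : ℤ[X]) (j : ℕ) :
    ((X ^ 2 - 1) * derivative H - H * (2 * X)).coeff (j + 1) =
      ((j : ℤ) - 2) * H.coeff j - ((j : ℤ) + 2) * H.coeff (j + 2) := by
  rw [sub_mul, one_mul, show H * (2 * X) = C 2 * (X * H) by
    rw [map_ofNat]; ring]
  rw [coeff_sub, coeff_sub, coeff_C_mul, coeff_X_mul, coeff_derivative]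
  cases j with
  | zero =>
    rw [pow_two, mul_assoc, coeff_X_mul, coeff_X_mul_zero]
    push_cast
    ring_nf
  | succ j =>
    rw [show j + 1 + 1 = j + 2 by ring, coeff_X_pow_mul, coeff_derivative]
    push_cast
    ring_nf

section Remainder

variable {M : ℕ} {R : ℤ[X]}

theorem two_mul_coeff_remainder
    (h : C (2 * (M : ℤ)) * (X * R) = wronskHe ![2, 2 * (M + 1)]) (j : ℕ) :
    2 * (M : ℤ) * R.coeff j = ((j : ℤ) - 2) * (He (2 * (M + 1))).coeff j -
      ((j : ℤ) + 2) * (He (2 * (M + 1))).coeff (j + 2) := by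
  have h2 : He 2 = X ^ 2 - 1 := by simp [He, pow_two]
  have h2' : derivative (He 2) = 2 * X := by
    rw [derivative_He_succ]
    simp [He, one_add_one_eq_two]
  rw [wronskHe_pair, h2', h2] at h
  rw [← coeff_wronskian_two, ← h, coeff_C_mul, coeff_X_mul]

theorem coeff_remainder_of_odd (hM : M ≠ 0)
    (h : C (2 * (M : ℤ)) * (X * R) = wronskHe ![2, 2 * (M + 1)]) {j : ℕ} (hj : Odd j) :
    R.coeff j = 0 := by
  have := two_mul_coeff_remainder h j
  rw [coeff_He_of_odd hj, coeff_He_of_odd (by grind)] at this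
  simpa [hM] using this

theorem coeff_remainder_two_mul (hM : M ≠ 0)
    (h : C (2 * (M : ℤ)) * (X * R) = wronskHe ![2, 2 * (M + 1)]) (t : ℕ) :
    R.coeff (2 * (t + 1)) * (M * (2 * (t + 1) + 1).factorial : ℕ) =
      (-1) ^ (t + 1) * R.coeff 0 * ((M + 2 * ((t + 1) * t)) *
        (2 ^ (t + 1) * ((t + 1).factorial * (M + 1).choose (t + 1))) : ℕ) := by
  have key : ∀ k : ℕ, (M : ℤ) * (2 * k + 1) * R.coeff (2 * k) =
      (M + 2 * (k * (k - 1))) * (He (2 * (M + 1))).coeff (2 * k) := by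
    intro k
    have h1 := two_mul_coeff_remainder h (2 * k)
    have h2 := coeff_He_add_two (2 * (M + 1)) (2 * k)
    push_cast at h1 h2
    refine mul_left_cancel₀ (two_ne_zero (α := ℤ)) ?_
    linear_combination (2 * (k : ℤ) + 1) * h1 - h2
  have h0 : R.coeff 0 = (He (2 * (M + 1))).coeff 0 := by
    have := key 0
    simpa [hM] using this
  have h1 := key (t + 1)
  have h2 := coeff_He_two_mul (M + 1) (t + 1)
  rw [← h0] at h2
  rw [Nat.factorial_succ]
  push_cast at h1 h2 ⊢
  linear_combination ((2 * (t + 1)).factorial : ℤ) * h1 +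
    ((M : ℤ) + 2 * ((t + 1) * t)) * h2

theorem padicValInt_coeff_remainder (hM : M ≠ 0)
    (h : C (2 * (M : ℤ)) * (X * R) = wronskHe ![2, 2 * (M + 1)]) (hR0 : R.coeff 0 ≠ 0) {t : ℕ}
    (ht : t ≤ M) :
    R.coeff (2 * (t + 1)) ≠ 0 ∧
    padicValInt 3 (R.coeff (2 * (t + 1))) + padicValNat 3 M +
        padicValNat 3 (2 * (t + 1) + 1).factorial =
      padicValInt 3 (R.coeff 0) + padicValNat 3 (M + 2 * ((t + 1) * t)) +
        padicValNat 3 ((t + 1).factorial * (M + 1).choose (t + 1)) := by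
  have e := congrArg Int.natAbs (coeff_remainder_two_mul hM h t)
  simp only [Int.natAbs_mul, Int.natAbs_pow, Int.natAbs_neg, Int.natAbs_one, one_pow,
    one_mul, Int.natAbs_natCast] at e
  have hr0 : (R.coeff 0).natAbs ≠ 0 := Int.natAbs_ne_zero.mpr hR0
  have hs : M + 2 * ((t + 1) * t) ≠ 0 := by omega
  have hp : (2 : ℕ) ^ (t + 1) ≠ 0 := by positivity
  have hc : (t + 1).factorial * (M + 1).choose (t + 1) ≠ 0 :=
    mul_ne_zero (Nat.factorial_ne_zero _) (Nat.choose_pos (by omega)).ne'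
  have hk : (R.coeff (2 * (t + 1))).natAbs ≠ 0 := by
    intro h0
    rw [h0, zero_mul] at e
    exact mul_ne_zero hr0 (mul_ne_zero hs (mul_ne_zero hp hc)) e.symm
  refine ⟨Int.natAbs_ne_zero.mp hk, ?_⟩
  have e' := congrArg (padicValNat 3) e
  have h32 : padicValNat 3 (2 ^ (t + 1)) = 0 :=
    padicValNat.eq_zero_of_not_dvd fun hd => by
      have := Nat.prime_three.dvd_of_dvd_pow hd
      omega
  rw [padicValNat.mul hk (mul_ne_zero hM (Nat.factorial_ne_zero _)),
    padicValNat.mul hM (Nat.factorial_ne_zero _),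
    padicValNat.mul hr0 (mul_ne_zero hs (mul_ne_zero hp hc)),
    padicValNat.mul hs (mul_ne_zero hp hc), padicValNat.mul hp hc, h32] at e'
  unfold padicValInt
  omega

end Remainder

theorem padicValNat_three_factorial_le (k : ℕ) : padicValNat 3 (2 * k + 1).factorial ≤ k := by
  have := sub_one_mul_padicValNat_factorial_lt_of_ne_zero 3 (n := 2 * k + 1) (by omega)
  omega

theorem dvd_factorial_mul_choose (M t : ℕ) :
    M ∣ (t + 2).factorial * (M + 1).choose (t + 2) := by
  rw [← Nat.descFactorial_eq_factorial_mul_choose, Nat.succ_descFactorial_succ]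
  cases M with
  | zero => simp
  | succ M =>
    rw [Nat.succ_descFactorial_succ]
    exact (Dvd.intro _ rfl).mul_left _

/-- The comparison of the coefficients at `0` and `2 (t + 1)` of the remainder polynomial,
in its nonstrict form and its strict form for `3 ∣ M + 1`. -/
theorem padicValInt_remainder_le {M : ℕ} {R : ℤ[X]} (hM : M ≠ 0)
    (h : C (2 * (M : ℤ)) * (X * R) = wronskHe ![2, 2 * (M + 1)]) (hR0 : R.coeff 0 ≠ 0) {t : ℕ}
    (ht : t ≤ M) :
    padicValInt 3 (R.coeff 0) ≤ padicValInt 3 (R.coeff (2 * (t + 1))) + (t + 1) ∧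
    (3 ∣ M + 1 →
      padicValInt 3 (R.coeff 0) < padicValInt 3 (R.coeff (2 * (t + 1))) + (t + 1)) ∧
    (¬ 3 ∣ M + 1 → t = 0 →
      padicValInt 3 (R.coeff 0) = padicValInt 3 (R.coeff (2 * (t + 1))) + (t + 1)) := by
  obtain ⟨-, e⟩ := padicValInt_coeff_remainder hM h hR0 ht
  have hfac := padicValNat_three_factorial_le (t + 1)
  rcases t with _ | t
  · have h6 : padicValNat 3 6 = 1 := by
      rw [show 6 = 3 * 2 by rfl, padicValNat.mul (by norm_num) (by norm_num),
        padicValNat_self, padicValNat.eq_zero_of_not_dvd (by norm_num)]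
    norm_num [Nat.factorial, h6] at e ⊢
    refine ⟨by omega, fun hd => ?_, fun hd => ?_⟩
    · have := one_le_padicValNat_of_dvd (p := 3) (by omega) hd
      omega
    · have := padicValNat.eq_zero_of_not_dvd hd
      omega
  · have hch : (M + 1).choose (t + 2) ≠ 0 := (Nat.choose_pos (by omega)).ne'
    have hc : (t + 2).factorial * (M + 1).choose (t + 2) ≠ 0 :=
      mul_ne_zero (Nat.factorial_ne_zero _) hch
    have hle := padicValNat_dvd_iff_le (p := 3) hc |>.mp
      (pow_padicValNat_dvd.trans (dvd_factorial_mul_choose M t))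
    simp only [add_assoc, Nat.reduceAdd] at *
    refine ⟨by omega, fun hd => ?_, fun _ h0 => by omega⟩
    have hM3 : padicValNat 3 M = 0 := padicValNat.eq_zero_of_not_dvd (by omega)
    rcases t with _ | t
    · have h120 : padicValNat 3 (Nat.factorial (2 * (0 + 2) + 1)) = 1 := by
        rw [show Nat.factorial (2 * (0 + 2) + 1) = 3 * 40 by rfl, padicValNat.mul (by norm_num) (by norm_num),
          padicValNat_self, padicValNat.eq_zero_of_not_dvd (by norm_num)]
      omega
    · have h3 : 3 ∣ (t + 1 + 2).factorial * (M + 1).choose (t + 1 + 2) :=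
        (Nat.dvd_factorial (by norm_num) (by omega)).mul_right _
      have := one_le_padicValNat_of_dvd (p := 3) hc h3
      omega

/-- Lemma `lem:slope_for_3`.  Let `n ≥ 3` be odd and write
`R_{n,2} = Σ_{i=0}^{n+1} a_i X^i` (`deg R_{n,2} = n + 1` since `s_{(n,2)} = 1`).
If `3 ∣ n + 1` then `ν_3(a_0) - ν_3(a_j) < j/2` for all `1 ≤ j ≤ n+1`; otherwise
`ν_3(a_0) - ν_3(a_j) ≤ j/2` for all `1 ≤ j ≤ n+1`, with equality for some `j`.
(For `a_j = 0` one has `ν_3(a_j) = ∞` and the inequality is vacuous, so the bounds are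
stated with the guard `a_j ≠ 0`.) -/
theorem stmt17 (n : ℕ) (hn : 3 ≤ n) (hodd : Odd n)
    (HeL RL : Polynomial ℤ)
    (hHe : Polynomial.C (vand (degSeq ![n, 2])) * HeL = wronskHe (degSeq ![n, 2]))
    (hR : HeL = Polynomial.X ^ sStat (degSeq ![n, 2]) * RL)
    (hR0 : RL.coeff 0 ≠ 0) :
    ((3 ∣ n + 1) →
      ∀ j : ℕ, 1 ≤ j → j ≤ n + 1 → RL.coeff j ≠ 0 →
        (padicValInt 3 (RL.coeff 0) : ℚ) - (padicValInt 3 (RL.coeff j) : ℚ)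
          < (j : ℚ) / 2) ∧
    (¬ (3 ∣ n + 1) →
      (∀ j : ℕ, 1 ≤ j → j ≤ n + 1 → RL.coeff j ≠ 0 →
        (padicValInt 3 (RL.coeff 0) : ℚ) - (padicValInt 3 (RL.coeff j) : ℚ)
          ≤ (j : ℚ) / 2) ∧
      ∃ j : ℕ, 1 ≤ j ∧ j ≤ n + 1 ∧ RL.coeff j ≠ 0 ∧
        (padicValInt 3 (RL.coeff 0) : ℚ) - (padicValInt 3 (RL.coeff j) : ℚ)
          = (j : ℚ) / 2) := by
  obtain ⟨M, rfl⟩ : ∃ M, n = 2 * M + 1 := hodd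
  have hM : M ≠ 0 := by omega
  have hdeg : degSeq ![2 * M + 1, 2] = ![2, 2 * (M + 1)] := degSeq_pair _ _
  rw [hR, hdeg, sStat_pair_even (by decide) (even_two_mul _), pow_one, vand_pair,
    show ((2 * (M + 1) : ℕ) : ℤ) - (2 : ℕ) = 2 * (M : ℤ) by push_cast; ring] at hHe
  have hdvd : 3 ∣ 2 * M + 1 + 1 ↔ 3 ∣ M + 1 := by omega
  have even_form : ∀ j : ℕ, 1 ≤ j → j ≤ 2 * M + 1 + 1 → RL.coeff j ≠ 0 →
      ∃ t ≤ M, j = 2 * (t + 1) := by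
    intro j hj1 hj hne
    rcases Nat.even_or_odd j with he | ho
    · obtain ⟨s, rfl⟩ := he
      exact ⟨s - 1, by omega, by omega⟩
    · exact absurd (coeff_remainder_of_odd hM hHe ho) hne
  rw [hdvd]
  refine ⟨fun h3 j hj1 hj hne => ?_, fun h3 => ⟨fun j hj1 hj hne => ?_, 2, by omega, by omega, ?_⟩⟩
  · obtain ⟨t, ht, rfl⟩ := even_form j hj1 hj hne
    have := (padicValInt_remainder_le hM hHe hR0 ht).2.1 h3
    qify at this
    push_cast
    linarith
  · obtain ⟨t, ht, rfl⟩ := even_form j hj1 hj hne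
    have := (padicValInt_remainder_le hM hHe hR0 ht).1
    qify at this
    push_cast
    linarith
  · refine ⟨(padicValInt_coeff_remainder hM hHe hR0 (Nat.zero_le M)).1, ?_⟩
    have := (padicValInt_remainder_le hM hHe hR0 (Nat.zero_le M)).2.2 h3 rfl
    qify at this
    norm_num at this ⊢
    linarith
end
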